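/- arXiv:2108.11691 — 5 statements merged into one kernel-verified Lean document; each statement's English description precedes it below -/
import Mathlib

section
/- For every non-identity element s ∈ S one has C_V(s) = C_V(S). Moreover, the additive subgroup [V,S] of V generated by all elements t • w - w (for t ∈ S, w ∈ V) equals C_V(S), and for every vector v ∈ V with v ∉ C_V(S), already the set {t • v - v : t ∈ S} equals C_V(S). -/
open Matrix

/-- The action of `SL₂(GF(pⁿ))` on its natural module `V = GF(pⁿ)²`. -/
noncomputable def act (p n : ℕ) [Fact p.Prime]
    (g : SpecialLinearGroup (Fin 2) (GaloisField p n)) (v : Fin 2 → GaloisField p n) :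
    Fin 2 → GaloisField p n :=
  Matrix.mulVec (g : Matrix (Fin 2) (Fin 2) (GaloisField p n)) v

/-- `C_V(T)`: the set of vectors fixed by every element of the subset `T` of `SL₂(GF(pⁿ))`. -/
def CV (p n : ℕ) [Fact p.Prime]
    (T : Set (SpecialLinearGroup (Fin 2) (GaloisField p n))) :
    Set (Fin 2 → GaloisField p n) :=
  {v | ∀ g ∈ T, act p n g v = v}

section Transvection

variable {K : Type*} [Field K]

/-- The standard symplectic form on `K²`. -/
def wedge (u v : Fin 2 → K) : K := u 0 * v 1 - u 1 * v 0

/-- The transvection `v ↦ v + (a * wedge u v) • u` of `K²`. -/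
def planeTransvection (u : Fin 2 → K) (a : K) : SpecialLinearGroup (Fin 2) K :=
  ⟨!![1 - a * u 0 * u 1, a * u 0 * u 0; -(a * u 1 * u 1), 1 + a * u 0 * u 1], by
    rw [det_fin_two_of]; ring⟩

lemma planeTransvection_mulVec (u v : Fin 2 → K) (a : K) :
    (planeTransvection u a : Matrix (Fin 2) (Fin 2) K) *ᵥ v = v + (a * wedge u v) • u := by
  ext i
  fin_cases i <;> simp [planeTransvection, wedge, mulVec, dotProduct, Fin.sum_univ_two] <;> ring

lemma planeTransvection_zero (u : Fin 2 → K) : planeTransvection u 0 = 1 := by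
  ext i j
  fin_cases i <;> fin_cases j <;> simp [planeTransvection]

lemma planeTransvection_mul (u : Fin 2 → K) (a b : K) :
    planeTransvection u a * planeTransvection u b = planeTransvection u (a + b) := by
  ext i j
  rw [Matrix.SpecialLinearGroup.coe_mul]
  fin_cases i <;> fin_cases j <;>
    simp [planeTransvection, mul_apply, Fin.sum_univ_two] <;> ring

lemma planeTransvection_pow (u : Fin 2 → K) (a : K) (k : ℕ) :
    planeTransvection u a ^ k = planeTransvection u (k * a) := by
  induction k with
  | zero => simp [planeTransvection_zero]
  | succ k ih => rw [pow_succ, ih, planeTransvection_mul]; congr 1; push_cast; ring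

/-- An element of `SL₂(K)` fixing a nonzero vector is a transvection along that vector. -/
lemma exists_eq_planeTransvection {u : Fin 2 → K} (hu : u ≠ 0) {g : SpecialLinearGroup (Fin 2) K}
    (hg : (g : Matrix (Fin 2) (Fin 2) K) *ᵥ u = u) : ∃ a, g = planeTransvection u a := by
  have hdet := g.det_coe
  rw [det_fin_two] at hdet
  have h0 := congrFun hg 0
  have h1 := congrFun hg 1
  simp only [mulVec, dotProduct, Fin.sum_univ_two] at h0 h1
  by_cases hu0 : u 0 = 0
  · have hu1 : u 1 ≠ 0 := fun h => hu (by ext i; fin_cases i <;> assumption)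
    refine ⟨-(g 1 0) / (u 1 * u 1), ?_⟩
    ext i j
    fin_cases i <;> fin_cases j <;> simp [planeTransvection] <;> grind
  · refine ⟨g 0 1 / (u 0 * u 0), ?_⟩
    ext i j
    fin_cases i <;> fin_cases j <;> simp [planeTransvection] <;> grind

lemma wedge_smul_self (u : Fin 2 → K) (c : K) : wedge u (c • u) = 0 := by
  simp [wedge]; ring

lemma exists_eq_smul_of_wedge_eq_zero {u v : Fin 2 → K} (hu : u ≠ 0) (h : wedge u v = 0) :
    ∃ c : K, v = c • u := by
  unfold wedge at h
  by_cases hu0 : u 0 = 0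
  · have hu1 : u 1 ≠ 0 := fun h => hu (by ext i; fin_cases i <;> assumption)
    refine ⟨v 1 / u 1, ?_⟩
    ext i
    fin_cases i <;> simp <;> grind
  · refine ⟨v 0 / u 0, ?_⟩
    ext i
    fin_cases i <;> simp <;> grind

lemma exists_wedge_ne_zero {u : Fin 2 → K} (hu : u ≠ 0) : ∃ v, wedge u v ≠ 0 := by
  by_contra! h
  refine hu ?_
  ext i
  fin_cases i
  · simpa [wedge] using h ![0, 1]
  · simpa [wedge] using h ![1, 0]

/-- The stabilizer in `SL₂(K)` of a vector of `K²`. -/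
def vectorStabilizer (u : Fin 2 → K) : Subgroup (SpecialLinearGroup (Fin 2) K) :=
  MulAction.stabilizer _ u

lemma mem_vectorStabilizer_iff {u : Fin 2 → K} (hu : u ≠ 0)
    {g : SpecialLinearGroup (Fin 2) K} :
    g ∈ vectorStabilizer u ↔ ∃ a, g = planeTransvection u a := by
  constructor
  · exact fun hg => exists_eq_planeTransvection hu hg
  · rintro ⟨a, rfl⟩
    refine (planeTransvection_mulVec u u a).trans ?_
    simp [wedge, mul_comm]

lemma isPGroup_vectorStabilizer (p : ℕ) [CharP K p] {u : Fin 2 → K} (hu : u ≠ 0) :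
    IsPGroup p (vectorStabilizer u) := by
  rintro ⟨g, hg⟩
  obtain ⟨a, rfl⟩ := (mem_vectorStabilizer_iff hu).1 hg
  refine ⟨1, Subtype.ext ?_⟩
  simp [planeTransvection_pow, planeTransvection_zero]

/-- A Sylow `p`-subgroup of `SL₂(K)`, for `K` a finite field of characteristic `p`, is the
stabilizer of a nonzero vector. -/
lemma exists_sylow_eq_vectorStabilizer (p : ℕ) [Fact p.Prime] [CharP K p] [Finite K]
    (S : Sylow p (SpecialLinearGroup (Fin 2) K)) :
    ∃ u : Fin 2 → K, u ≠ 0 ∧ (S : Subgroup _) = vectorStabilizer u := by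
  have hdvd : p ∣ Nat.card (Fin 2 → K) := by
    have := Fintype.ofFinite K
    obtain ⟨m, -, hm⟩ := FiniteField.card K p
    simp only [Nat.card_eq_fintype_card, Fintype.card_pi, hm, Finset.prod_const]
    exact dvd_pow (dvd_pow_self p m.ne_zero) (by simp)
  obtain ⟨u, hu, hu0⟩ := S.isPGroup'.exists_fixed_point_of_prime_dvd_card_of_fixed_point
    (Fin 2 → K) hdvd (a := 0) (fun g => smul_zero g)
  refine ⟨u, hu0.symm, ?_⟩
  refine (S.is_maximal' (isPGroup_vectorStabilizer p hu0.symm) ?_).symm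
  exact fun g hg => hu ⟨g, hg⟩

end Transvection

/-- For every non-identity `s ∈ S`, `C_V(s) = C_V(S)`; the additive subgroup `[V,S]`
generated by all `t • w - w` equals `C_V(S)`; and for `v ∉ C_V(S)` already
`{t • v - v : t ∈ S} = C_V(S)`. -/
theorem sl2_natural_module_commutators
    (p n : ℕ) [Fact p.Prime] (hn : 0 < n)
    (S : Sylow p (SpecialLinearGroup (Fin 2) (GaloisField p n))) :
    (∀ s ∈ S, s ≠ 1 → CV p n {s} = CV p n ↑S) ∧
    ((AddSubgroup.closure {x : Fin 2 → GaloisField p n |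
        ∃ t ∈ S, ∃ w : Fin 2 → GaloisField p n, x = act p n t w - w} :
      Set (Fin 2 → GaloisField p n)) = CV p n ↑S) ∧
    (∀ v : Fin 2 → GaloisField p n, v ∉ CV p n ↑S →
      {x : Fin 2 → GaloisField p n | ∃ t ∈ S, x = act p n t v - v} = CV p n ↑S) := by
  obtain ⟨u, hu, hS⟩ := exists_sylow_eq_vectorStabilizer p S
  have mem_S : ∀ g, g ∈ S ↔ ∃ a, g = planeTransvection u a := fun g => by
    rw [← mem_vectorStabilizer_iff hu, ← hS]; rfl
  have act_eq : ∀ a w, act p n (planeTransvection u a) w = w + (a * wedge u w) • u :=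
    fun a w => planeTransvection_mulVec u w a
  have act_fixed : ∀ {a w}, a ≠ 0 → act p n (planeTransvection u a) w = w → wedge u w = 0 := by
    intro a w ha h
    simpa [act_eq, ha, hu] using h
  have mem_CV : ∀ w, w ∈ CV p n (S : Set _) ↔ wedge u w = 0 := by
    refine fun w => ⟨fun h => act_fixed one_ne_zero (h _ ((mem_S _).2 ⟨1, rfl⟩)), ?_⟩
    intro h g hg
    obtain ⟨a, rfl⟩ := (mem_S g).1 hg
    simp [act_eq, h]
  have commutator_mem : ∀ t ∈ S, ∀ w, act p n t w - w ∈ CV p n (S : Set _) := by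
    intro t ht w
    obtain ⟨a, rfl⟩ := (mem_S t).1 ht
    rw [mem_CV, act_eq, add_sub_cancel_left, wedge_smul_self]
  have mem_commutator : ∀ v, wedge u v ≠ 0 → ∀ x ∈ CV p n (S : Set _),
      ∃ t ∈ S, x = act p n t v - v := by
    intro v hv x hx
    obtain ⟨c, rfl⟩ := exists_eq_smul_of_wedge_eq_zero hu ((mem_CV x).1 hx)
    refine ⟨planeTransvection u (c / wedge u v), (mem_S _).2 ⟨_, rfl⟩, ?_⟩
    rw [act_eq, add_sub_cancel_left, div_mul_cancel₀ _ hv]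
  refine ⟨fun s hs hs1 => ?_, ?_, fun v hv => ?_⟩
  · obtain ⟨a, rfl⟩ := (mem_S s).1 hs
    have ha : a ≠ 0 := fun h => hs1 (by rw [h, planeTransvection_zero])
    refine Set.Subset.antisymm (fun w hw => (mem_CV w).2 (act_fixed ha (hw _ rfl))) ?_
    rintro w hw g rfl
    exact hw _ hs
  · refine Set.Subset.antisymm (fun x hx => ?_) fun x hx => ?_
    · induction hx using AddSubgroup.closure_induction with
      | mem x hx =>
        obtain ⟨t, ht, w, rfl⟩ := hx
        exact commutator_mem t ht w
      | zero => exact (mem_CV 0).2 (by simp [wedge])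
      | add x y _ _ hx hy =>
        rw [mem_CV] at hx hy ⊢
        simp only [wedge, Pi.add_apply] at hx hy ⊢
        linear_combination hx + hy
      | neg x _ hx =>
        rw [mem_CV] at hx ⊢
        simp only [wedge, Pi.neg_apply] at hx ⊢
        linear_combination -hx
    · obtain ⟨v, hv⟩ := exists_wedge_ne_zero hu
      obtain ⟨t, ht, rfl⟩ := mem_commutator v hv x hx
      exact AddSubgroup.subset_closure ⟨t, ht, v, rfl⟩
  · refine Set.Subset.antisymm ?_ (mem_commutator v fun h => hv ((mem_CV v).2 h))
    rintro x ⟨t, ht, rfl⟩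
    exact commutator_mem t ht v
end

section
/- Every non-identity element g ∈ G whose order is coprime to p acts fixed-point-freely on the natural module V: if v ∈ V satisfies g • v = v, then v = 0. -/
open Matrix

/-- An element of `SL₂` over an integral domain that fixes a nonzero vector satisfies
`(g - 1)² = 0`. -/
theorem Matrix.SpecialLinearGroup.sub_one_sq_eq_zero_of_mulVec_eq_self {R : Type*} [CommRing R]
    [IsDomain R] (g : SpecialLinearGroup (Fin 2) R) {v : Fin 2 → R} (hv : v ≠ 0)
    (h : (g : Matrix (Fin 2) (Fin 2) R) *ᵥ v = v) :
    ((g : Matrix (Fin 2) (Fin 2) R) - 1) ^ 2 = 0 := by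
  have hdet : ((g : Matrix (Fin 2) (Fin 2) R) - 1).det = 0 :=
    Matrix.exists_mulVec_eq_zero_iff.mp ⟨v, hv, by rw [Matrix.sub_mulVec, h]; simp⟩
  have hone := g.det_coe
  rw [Matrix.det_fin_two] at hdet hone
  simp only [Matrix.sub_apply, Matrix.one_apply_eq, Matrix.one_apply_ne, ne_eq, zero_ne_one,
    one_ne_zero, not_false_eq_true, sub_zero] at hdet
  ext i j
  fin_cases i <;> fin_cases j <;>
    simp [sq, Matrix.mul_apply, Fin.sum_univ_two] <;> grind

/-- In characteristic `p`, an element of `SL₂` over an integral domain that fixes a nonzero vector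
has `p`-th power equal to `1`. -/
theorem Matrix.SpecialLinearGroup.pow_char_eq_one_of_mulVec_eq_self {R : Type*} [CommRing R]
    [IsDomain R] (p : ℕ) [Fact p.Prime] [CharP R p] (g : SpecialLinearGroup (Fin 2) R)
    {v : Fin 2 → R} (hv : v ≠ 0) (h : (g : Matrix (Fin 2) (Fin 2) R) *ᵥ v = v) :
    g ^ p = 1 := by
  have hp : ((g : Matrix (Fin 2) (Fin 2) R) - 1) ^ p = 0 :=
    pow_eq_zero_of_le (Fact.out : p.Prime).two_le (g.sub_one_sq_eq_zero_of_mulVec_eq_self hv h)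
  rw [sub_pow_char_of_commute p (Commute.one_right _), one_pow, sub_eq_zero] at hp
  apply Subtype.ext
  simpa using hp

/-- Every non-identity element of `SL₂(GF(pⁿ))` of order coprime to `p` acts
fixed-point-freely on the natural module. -/
theorem sl2_natural_module_coprime_elements_fixed_point_free
    (p n : ℕ) [Fact p.Prime] (hn : 0 < n)
    (g : SpecialLinearGroup (Fin 2) (GaloisField p n)) (hg : g ≠ 1)
    (hord : Nat.Coprime (orderOf g) p) :
    ∀ v : Fin 2 → GaloisField p n, act p n g v = v → v = 0 := by
  intro v hv
  by_contra hne
  have hdvd : orderOf g ∣ p :=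
    orderOf_dvd_of_pow_eq_one (g.pow_char_eq_one_of_mulVec_eq_self p hne hv)
  exact hg (orderOf_eq_one_iff.mp (Nat.Coprime.eq_one_of_dvd hord hdvd))
end

section
/- Let P be a Sylow p-subgroup of the general linear group GL_r(GF(q)). Then the exponent of P equals p^a, where a is the least natural number such that p^a ≥ r (equivalently, the least a with p^a > r - 1). -/
open Matrix

namespace Matrix

/-- A nilpotent square matrix over a domain vanishes at the power given by its size. -/
theorem pow_card_eq_zero_of_isNilpotent {ι R : Type*} [Fintype ι] [DecidableEq ι] [CommRing R]
    [IsDomain R] {M : Matrix ι ι R} (hM : IsNilpotent M) : M ^ Fintype.card ι = 0 := by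
  have h := (isNilpotent_charpoly_sub_pow_of_isNilpotent hM).eq_zero
  have hc := aeval_self_charpoly M
  rw [sub_eq_zero.mp h] at hc
  simpa using hc

/-- The `k`-th superdiagonal shift matrix. -/
def superdiagonal (R : Type*) [Zero R] [One R] (r k : ℕ) : Matrix (Fin r) (Fin r) R :=
  of fun i j => if (i : ℕ) + k = j then 1 else 0

theorem superdiagonal_one_pow {R : Type*} [Semiring R] (r k : ℕ) :
    superdiagonal R r 1 ^ k = superdiagonal R r k := by
  induction k with
  | zero =>
    ext i j
    simp [superdiagonal, one_apply, Fin.ext_iff]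
  | succ k ih =>
    rw [pow_succ, ih]
    ext i j
    simp only [superdiagonal, mul_apply, of_apply, ite_mul, one_mul, zero_mul]
    by_cases hik : (i : ℕ) + k < r
    · rw [Finset.sum_eq_single ⟨i + k, hik⟩]
      · simp [add_assoc]
      · intro l _ hl
        exact if_neg fun h => hl (Fin.ext h.symm)
      · simp
    · rw [if_neg (by omega)]
      exact Finset.sum_eq_zero fun l _ => if_neg (by omega)

theorem superdiagonal_eq_zero_iff {R : Type*} [Zero R] [One R] [NeZero (1 : R)] {r k : ℕ} :
    superdiagonal R r k = 0 ↔ r ≤ k := by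
  constructor
  · intro h
    by_contra! hk
    have := congr_fun₂ h (⟨0, by omega⟩ : Fin r) ⟨k, hk⟩
    simp [superdiagonal] at this
  · intro h
    ext i j
    exact if_neg (by omega)

/-- In characteristic `p`, a matrix `M` satisfies `M ^ p ^ k = 1` iff `(M - 1) ^ p ^ k = 0`. -/
theorem pow_char_pow_eq_one_iff {ι R : Type*} [Fintype ι] [DecidableEq ι] [Nonempty ι]
    [CommRing R] (p k : ℕ) [Fact p.Prime] [CharP R p] (M : Matrix ι ι R) :
    M ^ p ^ k = 1 ↔ (M - 1) ^ p ^ k = 0 := by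
  rw [sub_pow_char_pow_of_commute p k (Commute.one_right M), one_pow, sub_eq_zero]

end Matrix

/-- An element of `p`-power order is annihilated by the exponent of every Sylow `p`-subgroup. -/
theorem Sylow.pow_exponent_eq_one {G : Type*} [Group G] [Finite G] {p : ℕ} [Fact p.Prime]
    (P : Sylow p G) {g : G} {k : ℕ} (hg : g ^ p ^ k = 1) :
    g ^ Monoid.exponent (P : Subgroup G) = 1 := by
  have hz : IsPGroup p (Subgroup.zpowers g) := by
    rintro ⟨x, m, rfl⟩
    refine ⟨k, Subtype.ext ?_⟩
    change (g ^ m) ^ p ^ k = 1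
    rw [← zpow_natCast, ← _root_.zpow_mul, mul_comm, _root_.zpow_mul, zpow_natCast, hg,
      _root_.one_zpow]
  obtain ⟨Q, hQ⟩ := hz.exists_le_sylow
  rw [Monoid.exponent_eq_of_mulEquiv (P.equiv Q)]
  exact congr_arg Subtype.val
    (Monoid.pow_exponent_eq_one (⟨g, hQ (Subgroup.mem_zpowers g)⟩ : (Q : Subgroup G)))

/-- The exponent of a Sylow `p`-subgroup of `GL_r(GF(pⁿ))` is `p ^ a` where `a` is the
least natural number with `p ^ a ≥ r`. -/
theorem exponent_sylow_GL
    (p n r : ℕ) [Fact p.Prime] (hn : 0 < n) (hr : 0 < r)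
    (P : Sylow p (GL (Fin r) (GaloisField p n))) :
    Monoid.exponent ↥(P : Subgroup (GL (Fin r) (GaloisField p n))) =
      p ^ sInf {a : ℕ | r ≤ p ^ a} := by
  have hp : p.Prime := Fact.out
  have : NeZero r := ⟨hr.ne'⟩
  set a := sInf {a : ℕ | r ≤ p ^ a}
  have ha : r ≤ p ^ a :=
    Nat.sInf_mem (s := {a : ℕ | r ≤ p ^ a}) ⟨r, (Nat.lt_pow_self hp.one_lt).le⟩
  have hdvd : Monoid.exponent (P : Subgroup (GL (Fin r) (GaloisField p n))) ∣ p ^ a := by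
    rw [Monoid.exponent_dvd_iff_forall_pow_eq_one]
    intro g
    obtain ⟨k, hk⟩ := P.isPGroup' g
    have hk' : (g : GL (Fin r) (GaloisField p n)).val ^ p ^ k = 1 := by
      simpa using congr_arg Units.val (congr_arg Subtype.val hk)
    have hnil := pow_card_eq_zero_of_isNilpotent ⟨_, (pow_char_pow_eq_one_iff p k _).mp hk'⟩
    rw [Fintype.card_fin] at hnil
    have h1 := (pow_char_pow_eq_one_iff p a _).mpr (pow_eq_zero_of_le ha hnil)
    exact Subtype.ext (Units.ext (by simpa using h1))
  obtain ⟨b, hb, hexp⟩ := (Nat.dvd_prime_pow hp).mp hdvd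
  have hu : (1 + superdiagonal (GaloisField p n) r 1) ^ p ^ a = 1 := by
    rw [pow_char_pow_eq_one_iff, add_sub_cancel_left, superdiagonal_one_pow,
      superdiagonal_eq_zero_iff]
    exact ha
  have hub := P.pow_exponent_eq_one (Units.pow_ofPowEqOne hu (pow_ne_zero _ hp.ne_zero))
  rw [hexp] at hub ⊢
  have hub' : (1 + superdiagonal (GaloisField p n) r 1) ^ p ^ b = 1 := by
    simpa using congr_arg Units.val hub
  rw [pow_char_pow_eq_one_iff, add_sub_cancel_left, superdiagonal_one_pow,
    superdiagonal_eq_zero_iff] at hub'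
  rw [hb.antisymm (Nat.sInf_le hub')]
end

section
/- The Sylow p-subgroup S of PSU_4(q) has order q^6; its center Z(S) has order q; its derived subgroup ⁅S,S⁆ has order q^3 and contains Z(S); and its Thompson subgroup J(S) is elementary abelian of order q^4, contains ⁅S,S⁆, and satisfies C_S(J(S)) = J(S). -/
open Matrix

/-- The `q`-power Frobenius `x ↦ x ^ (pⁿ)` on `K = GF(q²)` where `q = pⁿ`. -/
noncomputable def frobq (p n : ℕ) [Fact p.Prime] :
    GaloisField p (2 * n) →+* GaloisField p (2 * n) :=
  iterateFrobenius (GaloisField p (2 * n)) p n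

/-- `SU₄(q)`: the subgroup of `SL₄(GF(q²))` of all matrices `A` with `Aᵀ ⬝ σ(A) = 1`,
where `σ` is the `q`-power Frobenius applied entrywise. -/
def SU4 (p n : ℕ) [Fact p.Prime] :
    Subgroup (SpecialLinearGroup (Fin 4) (GaloisField p (2 * n))) where
  carrier := {A | (A : Matrix (Fin 4) (Fin 4) (GaloisField p (2 * n)))ᵀ *
      (A : Matrix (Fin 4) (Fin 4) (GaloisField p (2 * n))).map (frobq p n) = 1}
  one_mem' := by
    simp
  mul_mem' := by
    intro A B hA hB
    simp only [Set.mem_setOf_eq, Matrix.SpecialLinearGroup.coe_mul, Matrix.transpose_mul,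
      Matrix.map_mul] at *
    calc (B : Matrix (Fin 4) (Fin 4) (GaloisField p (2*n)))ᵀ * (A : Matrix _ _ _)ᵀ *
          ((A : Matrix _ _ _).map (frobq p n) * (B : Matrix _ _ _).map (frobq p n))
        = (B : Matrix (Fin 4) (Fin 4) (GaloisField p (2*n)))ᵀ *
            (((A : Matrix _ _ _)ᵀ * (A : Matrix _ _ _).map (frobq p n)) *
              (B : Matrix _ _ _).map (frobq p n)) := by
          noncomm_ring
      _ = 1 := by rw [hA, one_mul, hB]
  inv_mem' := by
    intro A hA
    simp only [Set.mem_setOf_eq] at *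
    have h1 : (A : Matrix (Fin 4) (Fin 4) (GaloisField p (2*n))) *
        ((A⁻¹ : SpecialLinearGroup (Fin 4) (GaloisField p (2*n))) : Matrix _ _ _) = 1 := by
      rw [← Matrix.SpecialLinearGroup.coe_mul, mul_inv_cancel,
        Matrix.SpecialLinearGroup.coe_one]
    have hBt : ((A⁻¹ : SpecialLinearGroup (Fin 4) (GaloisField p (2*n))) : Matrix _ _ _)ᵀ =
        (A : Matrix (Fin 4) (Fin 4) (GaloisField p (2*n))).map (frobq p n) := by
      calc ((A⁻¹ : SpecialLinearGroup (Fin 4) (GaloisField p (2*n))) : Matrix _ _ _)ᵀ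
          = ((A⁻¹ : SpecialLinearGroup (Fin 4) (GaloisField p (2*n))) : Matrix _ _ _)ᵀ *
            ((A : Matrix (Fin 4) (Fin 4) (GaloisField p (2*n)))ᵀ *
              (A : Matrix _ _ _).map (frobq p n)) := by rw [hA, mul_one]
        _ = (((A : Matrix (Fin 4) (Fin 4) (GaloisField p (2*n))) *
              ((A⁻¹ : SpecialLinearGroup (Fin 4) (GaloisField p (2*n))) : Matrix _ _ _))ᵀ) *
            (A : Matrix _ _ _).map (frobq p n) := by
            rw [Matrix.transpose_mul]; noncomm_ring
        _ = (A : Matrix (Fin 4) (Fin 4) (GaloisField p (2*n))).map (frobq p n) := by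
            rw [h1, Matrix.transpose_one, one_mul]
    rw [hBt, ← Matrix.map_mul, h1, Matrix.map_one (frobq p n) (map_zero _) (map_one _)]

/-- `PSU₄(q)`: the quotient of `SU₄(q)` by its center. -/
noncomputable abbrev PSU4 (p n : ℕ) [Fact p.Prime] :=
  ↥(SU4 p n) ⧸ Subgroup.center ↥(SU4 p n)

/-- A subgroup is elementary abelian (for the prime `p`) if it is commutative and every
element has order dividing `p`. -/
def IsElementaryAbelian (p : ℕ) {G : Type*} [Group G] (A : Subgroup G) : Prop :=
  (∀ x ∈ A, ∀ y ∈ A, x * y = y * x) ∧ ∀ x ∈ A, x ^ p = 1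

/-- The Thompson subgroup `J(G)`: the subgroup generated by all elementary abelian
subgroups of maximal order. -/
def Thompson (p : ℕ) (G : Type*) [Group G] : Subgroup G :=
  ⨆ A ∈ {A : Subgroup G | IsElementaryAbelian p A ∧
      ∀ B : Subgroup G, IsElementaryAbelian p B → Nat.card B ≤ Nat.card A}, A

/-- Coordinates for the upper unitriangular matrices preserving the hermitian form with Gram matrix
`hyperbolicGram K`: see `UnitaryUnipotent.toMatrix`. -/
@[ext]
structure UnitaryUnipotent (K : Type*) [Field K] [StarRing K] where
  u : K
  a : K
  w : K
  b : K
  star_a : star a = -a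
  star_b : star b = -b

namespace UnitaryUnipotent

variable {K : Type*} [Field K] [StarRing K]

instance : Mul (UnitaryUnipotent K) where
  mul x y :=
    { u := x.u + y.u
      a := x.a + y.a + (y.u * star x.w - star y.u * x.w + y.u * star y.u * x.b)
      w := x.w + y.w - y.u * x.b
      b := x.b + y.b
      star_a := by simp [x.star_a, y.star_a, x.star_b]; ring
      star_b := by simp [x.star_b, y.star_b]; ring }

instance : One (UnitaryUnipotent K) where
  one := ⟨0, 0, 0, 0, by simp, by simp⟩

instance : Inv (UnitaryUnipotent K) where
  inv x :=
    { u := -x.u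
      a := -x.a + (x.u * star x.w - star x.u * x.w - x.u * star x.u * x.b)
      w := -x.w - x.u * x.b
      b := -x.b
      star_a := by simp [x.star_a, x.star_b]; ring
      star_b := by simp [x.star_b] }

@[simp] lemma mul_u (x y : UnitaryUnipotent K) : (x * y).u = x.u + y.u := rfl
@[simp] lemma mul_a (x y : UnitaryUnipotent K) : (x * y).a =
    x.a + y.a + (y.u * star x.w - star y.u * x.w + y.u * star y.u * x.b) := rfl
@[simp] lemma mul_w (x y : UnitaryUnipotent K) : (x * y).w = x.w + y.w - y.u * x.b := rfl
@[simp] lemma mul_b (x y : UnitaryUnipotent K) : (x * y).b = x.b + y.b := rfl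
@[simp] lemma one_u : (1 : UnitaryUnipotent K).u = 0 := rfl
@[simp] lemma one_a : (1 : UnitaryUnipotent K).a = 0 := rfl
@[simp] lemma one_w : (1 : UnitaryUnipotent K).w = 0 := rfl
@[simp] lemma one_b : (1 : UnitaryUnipotent K).b = 0 := rfl
lemma inv_u (x : UnitaryUnipotent K) : x⁻¹.u = -x.u := rfl
lemma inv_a (x : UnitaryUnipotent K) : x⁻¹.a =
    -x.a + (x.u * star x.w - star x.u * x.w - x.u * star x.u * x.b) := rfl
lemma inv_w (x : UnitaryUnipotent K) : x⁻¹.w = -x.w - x.u * x.b := rfl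
lemma inv_b (x : UnitaryUnipotent K) : x⁻¹.b = -x.b := rfl

instance : Group (UnitaryUnipotent K) :=
  Group.ofLeftAxioms
    (fun x y z => by ext <;> simp [x.star_b] <;> ring)
    (fun x => by ext <;> simp)
    (fun x => by ext <;> simp [inv_u, inv_a, inv_w, inv_b, x.star_b] <;> ring)

/-- The unitriangular matrix with coordinates `x`. -/
def toMatrix (x : UnitaryUnipotent K) : Matrix (Fin 4) (Fin 4) K :=
  !![1, x.u, x.w + x.u * x.b, x.a - x.u * star x.w;
     0, 1, x.b, -star x.w;
     0, 0, 1, -star x.u;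
     0, 0, 0, 1]

set_option maxHeartbeats 1000000 in
lemma toMatrix_mul (x y : UnitaryUnipotent K) : toMatrix (x * y) = toMatrix x * toMatrix y := by
  simp only [toMatrix, Matrix.cons_mul, Matrix.empty_mul, Matrix.vecMul_cons, Matrix.smul_cons,
    Matrix.smul_empty, Matrix.head_cons, Matrix.tail_cons, Equiv.symm_apply_apply,
    mul_u, mul_a, mul_w, mul_b, star_add, star_sub, star_mul', x.star_b]
  congr! 5 <;> simp <;> ring_nf <;> simp

lemma det_toMatrix (x : UnitaryUnipotent K) : (toMatrix x).det = 1 := by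
  simp [toMatrix, Matrix.det_succ_row_zero, Fin.sum_univ_succ]

variable (K) in
/-- The Gram matrix of the orthogonal sum of two hyperbolic planes. -/
def hyperbolicGram : Matrix (Fin 4) (Fin 4) K := !![0, 0, 0, 1; 0, 0, 1, 0; 0, 1, 0, 0; 1, 0, 0, 0]

lemma toMatrix_gram (x : UnitaryUnipotent K) :
    (toMatrix x)ᵀ * hyperbolicGram K * (toMatrix x).map (starRingEnd K) = hyperbolicGram K := by
  ext i j
  fin_cases i <;> fin_cases j <;>
    simp [toMatrix, hyperbolicGram, Matrix.mul_apply, Fin.sum_univ_four, x.star_b, x.star_a,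
      starRingEnd_apply] <;> ring

set_option maxHeartbeats 1000000 in
lemma exists_toMatrix_eq {B : Matrix (Fin 4) (Fin 4) K}
    (h10 : B 1 0 = 0) (h20 : B 2 0 = 0) (h30 : B 3 0 = 0) (h21 : B 2 1 = 0) (h31 : B 3 1 = 0)
    (h32 : B 3 2 = 0) (hd : ∀ i, B i i = 1)
    (h : Bᵀ * hyperbolicGram K * B.map (starRingEnd K) = hyperbolicGram K) :
    ∃ x, toMatrix x = B := by
  have e (i j) := congrFun (congrFun h i) j
  simp only [hyperbolicGram, Matrix.mul_apply, Fin.sum_univ_four, transpose_apply, map_apply,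
    starRingEnd_apply] at e
  have e22 := e 2 2
  have e31 := e 3 1
  have e32 := e 3 2
  have e33 := e 3 3
  simp [h21, h31, h32, hd] at e22 e31 e32 e33
  have s12 : star (B 1 2) = - B 1 2 := by linear_combination e22
  have s23 : B 2 3 = - star (B 0 1) := by linear_combination e31
  have s13 : B 1 3 = - star (B 0 2 - B 0 1 * B 1 2) := by
    simp only [star_sub, star_mul']
    linear_combination e32 - star (B 1 2) * s23
  refine ⟨⟨B 0 1, B 0 3 - B 0 1 * B 1 3, B 0 2 - B 0 1 * B 1 2, B 1 2, ?_, s12⟩, ?_⟩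
  · rw [s23] at e33
    simp only [star_sub, star_mul', star_neg, star_star] at e33 ⊢
    linear_combination e33
  · have hs : star (B 0 2 - B 0 1 * B 1 2) = - B 1 3 := by rw [s13, neg_neg]
    ext i j
    fin_cases i <;> fin_cases j <;>
      simp [toMatrix, hs, h10, h20, h30, h21, h31, h32, hd, -star_sub, -star_mul',
        -star_mul, ← s23]

/-- The coordinate `u` as a homomorphism. -/
def uHom : UnitaryUnipotent K →* Multiplicative K where
  toFun x := Multiplicative.ofAdd x.u
  map_one' := rfl
  map_mul' _ _ := rfl

/-- The pair of coordinates `(u, b)` as a homomorphism. -/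
def ubHom : UnitaryUnipotent K →* Multiplicative (K × K) where
  toFun x := Multiplicative.ofAdd (x.u, x.b)
  map_one' := rfl
  map_mul' _ _ := rfl

variable (K) in
/-- The abelian normal subgroup `u = 0`. -/
def radical : Subgroup (UnitaryUnipotent K) := uHom.ker

variable (K) in
/-- The subgroup `u = b = 0`. -/
def derived : Subgroup (UnitaryUnipotent K) := ubHom.ker

lemma mem_radical {x : UnitaryUnipotent K} : x ∈ radical K ↔ x.u = 0 := Iff.rfl

lemma mem_derived {x : UnitaryUnipotent K} : x ∈ derived K ↔ x.u = 0 ∧ x.b = 0 := by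
  change (x.u, x.b) = (0, 0) ↔ _
  simp

/-- The four coordinates as a bijection. -/
def equivProd : UnitaryUnipotent K ≃ K × K × skewAdjoint K × skewAdjoint K where
  toFun x := (x.u, x.w, ⟨x.a, x.star_a⟩, ⟨x.b, x.star_b⟩)
  invFun y := ⟨y.1, y.2.2.1, y.2.1, y.2.2.2, y.2.2.1.2, y.2.2.2.2⟩
  left_inv _ := rfl
  right_inv _ := rfl

/-- The coordinates `w`, `a`, `b` as a bijection on `radical K`. -/
def radicalEquiv : radical K ≃ K × skewAdjoint K × skewAdjoint K where
  toFun x := (x.1.w, ⟨x.1.a, x.1.star_a⟩, ⟨x.1.b, x.1.star_b⟩)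
  invFun y := ⟨⟨0, y.2.1, y.1, y.2.2, y.2.1.2, y.2.2.2⟩, rfl⟩
  left_inv := by
    rintro ⟨x, hx⟩
    ext <;> simp [mem_radical.1 hx]
  right_inv _ := rfl

/-- The coordinates `w`, `a` as a bijection on `derived K`. -/
def derivedEquiv : derived K ≃ K × skewAdjoint K where
  toFun x := (x.1.w, ⟨x.1.a, x.1.star_a⟩)
  invFun y := ⟨⟨0, y.2, y.1, 0, y.2.2, by simp⟩, mem_derived.2 ⟨rfl, rfl⟩⟩
  left_inv := by
    rintro ⟨x, hx⟩
    ext <;> simp [mem_derived.1 hx]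
  right_inv _ := rfl

lemma card_eq {q : ℕ} (hK : Nat.card K = q ^ 2) (hs : Nat.card (skewAdjoint K) = q) :
    Nat.card (UnitaryUnipotent K) = q ^ 6 := by
  simp only [Nat.card_congr equivProd, Nat.card_prod, hK, hs]; ring

lemma card_radical {q : ℕ} (hK : Nat.card K = q ^ 2) (hs : Nat.card (skewAdjoint K) = q) :
    Nat.card (radical K) = q ^ 4 := by
  simp only [Nat.card_congr radicalEquiv, Nat.card_prod, hK, hs]; ring

lemma card_derived {q : ℕ} (hK : Nat.card K = q ^ 2) (hs : Nat.card (skewAdjoint K) = q) :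
    Nat.card (derived K) = q ^ 3 := by
  simp only [Nat.card_congr derivedEquiv, Nat.card_prod, hK, hs]; ring

lemma radical_commute {x y : UnitaryUnipotent K} (hx : x ∈ radical K) (hy : y ∈ radical K) :
    x * y = y * x := by
  rw [mem_radical] at hx hy
  ext <;> simp [hx, hy, add_comm]

lemma pow_of_mem_radical {x : UnitaryUnipotent K} (hx : x ∈ radical K) (k : ℕ) :
    (x ^ k).u = 0 ∧ (x ^ k).a = k * x.a ∧ (x ^ k).w = k * x.w ∧ (x ^ k).b = k * x.b := by
  rw [mem_radical] at hx
  induction k with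
  | zero => simp
  | succ k ih => simp [pow_succ, ih, hx]; grind

lemma pow_char_of_mem_radical (p : ℕ) [CharP K p] {x : UnitaryUnipotent K} (hx : x ∈ radical K) :
    x ^ p = 1 := by
  have h := pow_of_mem_radical hx p
  ext <;> simp [h]

/-- Commuting with an element of the radical. -/
lemma commute_radical_iff {x v : UnitaryUnipotent K} (hv : v ∈ radical K) :
    x * v = v * x ↔ x.u * v.b = 0 ∧ x.u * star v.w = star x.u * v.w := by
  rw [mem_radical] at hv
  simp only [UnitaryUnipotent.ext_iff, mul_u, mul_a, mul_w, mul_b, hv, star_zero]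
  constructor
  · rintro ⟨-, h1, h2, -⟩
    have hb : x.u * v.b = 0 := by linear_combination h2
    exact ⟨hb, by linear_combination -h1 - star x.u * hb⟩
  · rintro ⟨h1, h2⟩
    exact ⟨by ring, by linear_combination -h2 - star x.u * h1, by linear_combination h1, by ring⟩

lemma exists_skew_ne_zero {q : ℕ} (hq : 1 < q) (hs : Nat.card (skewAdjoint K) = q) :
    ∃ b : K, star b = -b ∧ b ≠ 0 := by
  have : Finite (skewAdjoint K) := Nat.finite_of_card_ne_zero (by omega)
  have : Nontrivial (skewAdjoint K) := Finite.one_lt_card_iff_nontrivial.1 (by omega)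
  obtain ⟨b, hb⟩ := exists_ne (0 : skewAdjoint K)
  exact ⟨b, b.2, by simpa using hb⟩

lemma centralizer_radical {b : K} (hb : star b = -b) (hb0 : b ≠ 0) :
    Subgroup.centralizer (radical K : Set (UnitaryUnipotent K)) = radical K := by
  ext x
  rw [Subgroup.mem_centralizer_iff]
  refine ⟨fun h => ?_, fun hx v hv => radical_commute hv hx⟩
  have hv : (⟨0, 0, 0, b, by simp, hb⟩ : UnitaryUnipotent K) ∈ radical K := rfl
  exact (mul_eq_zero.1 ((commute_radical_iff hv).1 (h _ hv).symm).1).resolve_right hb0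

lemma mem_center_iff {b : K} (hb : star b = -b) (hb0 : b ≠ 0) {c : K} (hc : star c ≠ c)
    {x : UnitaryUnipotent K} :
    x ∈ Subgroup.center (UnitaryUnipotent K) ↔ x.u = 0 ∧ x.w = 0 ∧ x.b = 0 := by
  rw [Subgroup.mem_center_iff]
  constructor
  · intro h
    have hx : x ∈ radical K := by
      rw [← centralizer_radical hb hb0, Subgroup.mem_centralizer_iff]
      exact fun v _ => h v
    have h' (y) := (commute_radical_iff hx).1 (h y)
    have h1 := h' ⟨1, 0, 0, 0, by simp, by simp⟩
    have h2 := h' ⟨c, 0, 0, 0, by simp, by simp⟩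
    simp only [one_mul, star_one] at h1 h2
    refine ⟨hx, ?_, h1.1⟩
    by_contra hw
    rw [h1.2] at h2
    exact hc (mul_right_cancel₀ hw h2.2).symm
  · rintro ⟨h1, h2, h3⟩ y
    rw [commute_radical_iff h1]
    simp [h2, h3]

lemma card_center {b : K} (hb : star b = -b) (hb0 : b ≠ 0) {c : K} (hc : star c ≠ c) :
    Nat.card (Subgroup.center (UnitaryUnipotent K)) = Nat.card (skewAdjoint K) := by
  refine Nat.card_congr ⟨fun x => ⟨x.1.a, x.1.star_a⟩,
    fun a => ⟨⟨0, a, 0, 0, a.2, by simp⟩, (mem_center_iff hb hb0 hc).2 ⟨rfl, rfl, rfl⟩⟩, ?_, ?_⟩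
  · rintro ⟨x, hx⟩
    ext <;> simp [(mem_center_iff hb hb0 hc).1 hx]
  · exact fun _ => rfl

lemma commutator_eq {b : K} (hb : star b = -b) (hb0 : b ≠ 0)
    (hsurj : ∀ a : K, star a = -a → ∃ w, star w - w = a) :
    ⁅(⊤ : Subgroup (UnitaryUnipotent K)), ⊤⁆ = derived K := by
  apply le_antisymm
  · rw [Subgroup.commutator_le]
    rintro x - y -
    rw [mem_derived, commutatorElement_def]
    simp [inv_u, inv_b]
  · have comm (u w b : K) (hb : star b = -b) :
        (⟨0, u * star w - star u * w + u * star u * b, -(u * b), 0,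
          by simp [hb]; ring, by simp⟩ : UnitaryUnipotent K) ∈
          ⁅(⊤ : Subgroup (UnitaryUnipotent K)), (⊤ : Subgroup (UnitaryUnipotent K))⁆ := by
      have := Subgroup.commutator_mem_commutator
        (Subgroup.mem_top ((⟨0, 0, w, b, by simp, hb⟩ : UnitaryUnipotent K)⁻¹))
        (Subgroup.mem_top ((⟨u, 0, 0, 0, by simp, by simp⟩ : UnitaryUnipotent K)⁻¹))
      convert this using 1
      rw [commutatorElement_def, inv_inv, inv_inv]
      ext <;> simp [inv_u, inv_a, inv_w, inv_b, hb] <;> ring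
    intro x hx
    obtain ⟨hu, hb'⟩ := mem_derived.1 hx
    have h1 := comm (-x.w / b) 0 b hb
    obtain ⟨w, hw⟩ := hsurj (x.a - (-x.w / b) * star (-x.w / b) * b)
      (by simp [x.star_a, hb]; ring)
    have h2 := comm 1 w 0 (by simp)
    convert mul_mem h1 h2 using 1
    ext
    · simp [hu]
    · simp only [mul_a, star_one, one_mul, hw]; simp
    · simp; field_simp
    · simp [hb']

end UnitaryUnipotent

lemma IsElementaryAbelian.map {p : ℕ} {G H : Type*} [Group G] [Group H] (f : G →* H)
    {A : Subgroup G} (hA : IsElementaryAbelian p A) : IsElementaryAbelian p (A.map f) := by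
  constructor
  · rintro _ ⟨x, hx, rfl⟩ _ ⟨y, hy, rfl⟩
    rw [← map_mul, hA.1 x hx y hy, map_mul]
  · rintro _ ⟨x, hx, rfl⟩
    rw [← map_pow, hA.2 x hx, map_one]

lemma Thompson_map_le (p : ℕ) {G H : Type*} [Group G] [Group H] (e : G ≃* H) :
    (Thompson p G).map e.toMonoidHom ≤ Thompson p H := by
  rw [Thompson, Subgroup.map_iSup]
  refine iSup_le fun A => ?_
  rw [Subgroup.map_iSup]
  refine iSup_le fun ⟨hA, hmax⟩ => ?_
  refine le_iSup₂_of_le (A.map e.toMonoidHom) ⟨hA.map _, fun B hB => ?_⟩ le_rfl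
  have h := hmax _ (hB.map e.symm.toMonoidHom)
  rwa [Subgroup.card_map_of_injective e.symm.injective,
    ← Subgroup.card_map_of_injective (f := e.toMonoidHom) e.injective] at h

lemma Thompson_map (p : ℕ) {G H : Type*} [Group G] [Group H] (e : G ≃* H) :
    (Thompson p G).map e.toMonoidHom = Thompson p H := by
  refine le_antisymm (Thompson_map_le p e) fun x hx => ?_
  exact ⟨e.symm x, Thompson_map_le p e.symm ⟨x, hx, rfl⟩, by simp⟩

lemma Thompson_eq_of_card_lt {p : ℕ} {G : Type*} [Group G] [Finite G] {V : Subgroup G}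
    (hV : IsElementaryAbelian p V)
    (h : ∀ A : Subgroup G, IsElementaryAbelian p A → ¬ A ≤ V → Nat.card A < Nat.card V) :
    Thompson p G = V := by
  apply le_antisymm
  · refine iSup₂_le fun A ⟨hA, hmax⟩ => ?_
    by_contra hAV
    exact (h A hA hAV).not_ge (hmax V hV)
  · refine le_iSup₂_of_le V ⟨hV, fun B hB => ?_⟩ le_rfl
    by_cases hBV : B ≤ V
    · exact Nat.card_le_card_of_injective _ (Subgroup.inclusion_injective hBV)
    · exact (h B hB hBV).le

namespace UnitaryUnipotent

variable {K : Type*} [Field K] [StarRing K]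

instance [Finite K] : Finite (UnitaryUnipotent K) := Finite.of_equiv _ equivProd.symm

lemma card_lt_card_radical [Finite K] {q : ℕ} (hq : 1 < q) (hK : Nat.card K = q ^ 2)
    (hs : Nat.card (skewAdjoint K) = q) (hf : Nat.card (selfAdjoint K) = q)
    {c : K} (hc : star c ≠ c) {A : Subgroup (UnitaryUnipotent K)}
    (hA : ∀ x ∈ A, ∀ y ∈ A, x * y = y * x) (hAV : ¬ A ≤ radical K) :
    Nat.card A < Nat.card (radical K) := by
  obtain ⟨x, hxA, hx⟩ := SetLike.not_le_iff_exists.1 hAV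
  rw [mem_radical] at hx
  rw [card_radical hK hs]
  set f : A →* Multiplicative K := uHom.comp A.subtype with hfdef
  have hker (y : f.ker) (z : A) := (commute_radical_iff (x := z.1) (v := y.1.1) y.2).1
    (hA _ z.2 _ y.1.2)
  have hb (y : f.ker) : y.1.1.b = 0 := (mul_eq_zero.1 (hker y ⟨x, hxA⟩).1).resolve_left hx
  have hu (y : f.ker) : y.1.1.u = 0 := y.2
  have hcard : Nat.card A = Nat.card f.range * Nat.card f.ker := by
    rw [← Subgroup.index_ker, mul_comm, Subgroup.card_mul_index]
  have hrange : Nat.card f.range ≤ q ^ 2 := hK ▸ Subgroup.card_le_card_group f.range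
  have hpos : 0 < Nat.card f.range := Nat.card_pos
  by_cases htop : f.range = ⊤
  · have hw (y : f.ker) : y.1.1.w = 0 := by
      have hu' (u : K) : u * star y.1.1.w = star u * y.1.1.w := by
        obtain ⟨z, hz⟩ : Multiplicative.ofAdd u ∈ f.range := htop ▸ Subgroup.mem_top _
        have : z.1.u = u := hz
        exact this ▸ (hker y z).2
      by_contra hw
      have h1 := hu' 1
      have h2 := hu' c
      simp only [one_mul, star_one] at h1
      rw [h1] at h2
      exact hc (mul_right_cancel₀ hw h2).symm
    have : Nat.card f.ker ≤ q := by
      rw [← hs]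
      refine Nat.card_le_card_of_injective
        (fun y => (⟨y.1.1.a, y.1.1.star_a⟩ : skewAdjoint K)) fun y z h => ?_
      exact Subtype.ext <| Subtype.ext <| UnitaryUnipotent.ext ((hu y).trans (hu z).symm)
        (congrArg Subtype.val h) ((hw y).trans (hw z).symm) ((hb y).trans (hb z).symm)
    calc Nat.card A ≤ q ^ 2 * q := hcard ▸ Nat.mul_le_mul hrange this
      _ = q ^ 3 := by ring
      _ < q ^ 4 := Nat.pow_lt_pow_right hq (by norm_num)
  · have hlt : Nat.card f.range < q ^ 2 := by
      refine lt_of_le_of_ne hrange fun h => htop ?_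
      exact Subgroup.eq_top_of_card_eq _ (h.trans hK.symm)
    have : Nat.card f.ker ≤ q * q := by
      nth_rw 1 [← hs]
      rw [← hf, ← Nat.card_prod]
      have hself (y : f.ker) : star (y.1.1.w / x.u) = y.1.1.w / x.u := by
        have h := (hker y ⟨x, hxA⟩).2
        have hx' : star x.u ≠ 0 := by simpa using hx
        rw [star_div₀]
        field_simp
        linear_combination h
      refine Nat.card_le_card_of_injective
        (fun y => ((⟨y.1.1.a, y.1.1.star_a⟩ : skewAdjoint K),
          (⟨y.1.1.w / x.u, hself y⟩ : selfAdjoint K))) fun y z h => ?_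
      have hw := (div_left_inj' hx).1 (congrArg Subtype.val (congrArg Prod.snd h))
      exact Subtype.ext <| Subtype.ext <| UnitaryUnipotent.ext ((hu y).trans (hu z).symm)
        (congrArg Subtype.val (congrArg Prod.fst h)) hw ((hb y).trans (hb z).symm)
    calc Nat.card A < q ^ 2 * (q * q) :=
          hcard ▸ Nat.mul_lt_mul_of_lt_of_le hlt this (by positivity)
      _ = q ^ 4 := by ring

lemma Thompson_eq_radical (p : ℕ) [CharP K p] [Finite K] {q : ℕ} (hq : 1 < q)
    (hK : Nat.card K = q ^ 2)
    (hs : Nat.card (skewAdjoint K) = q) (hf : Nat.card (selfAdjoint K) = q)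
    {c : K} (hc : star c ≠ c) : Thompson p (UnitaryUnipotent K) = radical K :=
  Thompson_eq_of_card_lt
    ⟨fun _ hx _ hy => radical_commute hx hy, fun _ hx => pow_char_of_mem_radical p hx⟩
    fun _ hA hAV => card_lt_card_radical hq hK hs hf hc hA.1 hAV

end UnitaryUnipotent

section FiniteField

variable {K : Type*} [Field K]

lemma card_pow_eq_mul_le {q : ℕ} (hq : 1 < q) (a : K) (A : AddSubgroup K)
    (hA : ∀ x ∈ A, x ^ q = a * x) : Nat.card A ≤ q := by
  classical
  set P : Polynomial K := .X ^ q - .C a * .X with hP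
  have hdeg : P.natDegree = q := by
    rw [hP, Polynomial.natDegree_sub_eq_left_of_natDegree_lt, Polynomial.natDegree_X_pow]
    rw [Polynomial.natDegree_X_pow]
    exact ((Polynomial.natDegree_C_mul_le a _).trans Polynomial.natDegree_X_le).trans_lt hq
  have hP0 : P ≠ 0 := fun h => by simp [h] at hdeg; omega
  have hsub : (A : Set K) ⊆ P.roots.toFinset := fun x hx => by
    have : P.eval x = 0 := by simp [hP, hA x hx]
    simpa [hP0] using this
  calc Nat.card A ≤ Nat.card (P.roots.toFinset : Set K) :=
        Nat.card_mono (Finset.finite_toSet _) hsub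
    _ = P.roots.toFinset.card := by rw [Nat.card_coe_set_eq, Set.ncard_coe_finset]
    _ ≤ q := (Multiset.toFinset_card_le _).trans (hdeg ▸ P.card_roots')

variable [StarRing K] {q : ℕ}

lemma card_adjoint_and_surjective [Finite K] (hq : 1 < q) (hK : Nat.card K = q ^ 2)
    (hstar : ∀ x : K, star x = x ^ q) :
    Nat.card (selfAdjoint K) = q ∧ Nat.card (skewAdjoint K) = q ∧
      (∀ a : K, star a = -a → ∃ w, star w - w = a) ∧
      (∀ a : K, star a = a → ∃ w, star w + w = a) := by
  have hself : Nat.card (selfAdjoint K) ≤ q := card_pow_eq_mul_le hq 1 _ fun x hx => by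
    rw [← hstar, selfAdjoint.mem_iff.1 hx, one_mul]
  have hskew : Nat.card (skewAdjoint K) ≤ q := card_pow_eq_mul_le hq (-1) _ fun x hx => by
    rw [← hstar, skewAdjoint.mem_iff.1 hx, neg_one_mul]
  let f : K →+ K := (starAddEquiv : K ≃+ K).toAddMonoidHom - AddMonoidHom.id K
  let g : K →+ K := (starAddEquiv : K ≃+ K).toAddMonoidHom + AddMonoidHom.id K
  have hf (x : K) : f x = star x - x := rfl
  have hg (x : K) : g x = star x + x := rfl
  have hfk : f.ker = selfAdjoint K := by
    ext x; rw [AddMonoidHom.mem_ker, hf, selfAdjoint.mem_iff, sub_eq_zero]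
  have hgk : g.ker = skewAdjoint K := by
    ext x; rw [AddMonoidHom.mem_ker, hg, skewAdjoint.mem_iff, add_eq_zero_iff_eq_neg]
  have hfr : f.range ≤ skewAdjoint K := by
    rintro _ ⟨x, rfl⟩; rw [hf, skewAdjoint.mem_iff]; simp
  have hgr : g.range ≤ selfAdjoint K := by
    rintro _ ⟨x, rfl⟩; rw [hg, selfAdjoint.mem_iff]; simp [add_comm]
  have hfc : q ^ 2 = Nat.card f.range * Nat.card (selfAdjoint K) := by
    rw [← hK, ← hfk, ← AddSubgroup.index_ker, mul_comm, AddSubgroup.card_mul_index]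
  have hgc : q ^ 2 = Nat.card g.range * Nat.card (skewAdjoint K) := by
    rw [← hK, ← hgk, ← AddSubgroup.index_ker, mul_comm, AddSubgroup.card_mul_index]
  have hfr' := AddSubgroup.card_le_of_le hfr
  have hgr' := AddSubgroup.card_le_of_le hgr
  have h1 : Nat.card (selfAdjoint K) = q := by nlinarith
  have h2 : Nat.card (skewAdjoint K) = q := by nlinarith
  have h3 : f.range = skewAdjoint K := AddSubgroup.eq_of_le_of_card_ge hfr (by nlinarith)
  have h4 : g.range = selfAdjoint K := AddSubgroup.eq_of_le_of_card_ge hgr (by nlinarith)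
  refine ⟨h1, h2, fun a ha => ?_, fun a ha => ?_⟩
  · exact h3.ge (skewAdjoint.mem_iff.2 ha)
  · exact h4.ge (selfAdjoint.mem_iff.2 ha)

lemma exists_star_ne (hq : 1 < q) (hK : Nat.card K = q ^ 2)
    (hf : Nat.card (selfAdjoint K) = q) : ∃ c : K, star c ≠ c := by
  by_contra! h
  have : selfAdjoint K = ⊤ := by ext x; simp [selfAdjoint.mem_iff, h]
  rw [this, AddSubgroup.card_top, hK] at hf
  nlinarith

lemma exists_mul_star_eq_neg_one [Finite K] (hq : 1 < q) (hK : Nat.card K = q ^ 2)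
    (hstar : ∀ x : K, star x = x ^ q) : ∃ c : K, c * star c = -1 := by
  obtain ⟨g, hg⟩ := IsCyclic.exists_generator (α := Kˣ)
  obtain ⟨k, hk⟩ := Submonoid.mem_powers_iff _ _ |>.1 (mem_powers_iff_mem_zpowers.2 (hg (-1)))
  have hord : orderOf g = (q + 1) * (q - 1) := by
    rw [orderOf_eq_card_of_forall_mem_zpowers hg, Nat.card_units, hK, ← Nat.sq_sub_sq, one_pow]
  have hpow : g ^ (k * (q - 1)) = 1 := by
    rw [pow_mul, hk]
    have h : (-1 : K) ^ q = -1 := by rw [← hstar]; simp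
    have h' : (-1 : K) ^ (q - 1) * (-1) = 1 * (-1) := by
      rw [← pow_succ, Nat.sub_add_cancel hq.le, h, one_mul]
    ext
    simpa using h'
  rw [← orderOf_dvd_iff_pow_eq_one, hord] at hpow
  obtain ⟨m, rfl⟩ := Nat.dvd_of_mul_dvd_mul_right (by omega) hpow
  refine ⟨(g ^ m : Kˣ), ?_⟩
  rw [hstar, ← pow_succ', ← Units.val_pow_eq_pow_val, ← pow_mul, mul_comm, hk]
  simp

end FiniteField

lemma IsPGroup.eq_of_normalizer {p : ℕ} [Fact p.Prime] {G : Type*} [Group G] [Finite G]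
    {P : Subgroup G}
    (hP : ∀ x : G, (∀ y ∈ P, x⁻¹ * y * x ∈ P) → ∀ k : ℕ, x ^ p ^ k = 1 → x ∈ P)
    {Q : Subgroup G} (hQ : IsPGroup p Q) (hPQ : P ≤ Q) : Q = P := by
  by_contra hne
  have hlt : P.subgroupOf Q < ⊤ := by
    rw [lt_top_iff_ne_top, Ne, Subgroup.subgroupOf_eq_top]
    exact fun h => hne (le_antisymm h hPQ)
  have := hQ.isNilpotent
  obtain ⟨y, hy, hyP⟩ := SetLike.exists_of_lt (Group.normalizerCondition_of_isNilpotent _ hlt)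
  obtain ⟨k, hk⟩ := hQ y
  refine hyP (hP y (fun z hz => ?_) k ?_)
  · exact (Subgroup.mem_normalizer_iff''.1 hy ⟨z, hPQ hz⟩).1 hz
  · simpa [Subtype.ext_iff] using hk

lemma Matrix.upperTriangular_pow {ι R : Type*} [Fintype ι] [LinearOrder ι] [CommRing R]
    {B : Matrix ι ι R} (hB : ∀ i j, j < i → B i j = 0) (m : ℕ) :
    (∀ i j, j < i → (B ^ m) i j = 0) ∧ ∀ i, (B ^ m) i i = B i i ^ m := by
  induction m with
  | zero =>
    refine ⟨fun i j h => ?_, fun i => ?_⟩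
    · rw [pow_zero, Matrix.one_apply_ne h.ne']
    · simp
  | succ m ih =>
    refine ⟨fun i j h => ?_, fun i => ?_⟩
    · rw [pow_succ, Matrix.mul_apply]
      refine Finset.sum_eq_zero fun k _ => ?_
      rcases lt_or_ge k i with hk | hk
      · rw [ih.1 i k hk, zero_mul]
      · rw [hB k j (h.trans_le hk), mul_zero]
    · rw [pow_succ, Matrix.mul_apply, Finset.sum_eq_single i, ih.2, pow_succ]
      · intro k _ hk
        rcases lt_or_gt_of_ne hk with hk | hk
        · rw [ih.1 i k hk, zero_mul]
        · rw [hB k i hk, mul_zero]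
      · simp

namespace UnitaryUnipotent

variable {K : Type*} [Field K] [StarRing K]

lemma toMatrix_injective : Function.Injective (toMatrix : UnitaryUnipotent K → _) := by
  intro x y h
  have e (i j) := congrFun (congrFun h i) j
  have hu : x.u = y.u := e 0 1
  have hb : x.b = y.b := e 1 2
  have hw : x.w = y.w := by
    have := e 0 2
    simpa [toMatrix, hu, hb] using this
  have ha : x.a = y.a := by
    have := e 0 3
    simpa [toMatrix, hu, hw] using this
  exact UnitaryUnipotent.ext hu ha hw hb

lemma exists_toMatrix_eq_of_normalizes (p : ℕ) [Fact p.Prime] [CharP K p]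
    {b : K} (hb : star b = -b) (hb0 : b ≠ 0) {B : Matrix (Fin 4) (Fin 4) K}
    (hN : ∀ y : UnitaryUnipotent K, ∃ x, toMatrix y * B = B * toMatrix x)
    (h : Bᵀ * hyperbolicGram K * B.map (starRingEnd K) = hyperbolicGram K) {k : ℕ}
    (hk : B ^ p ^ k = 1) :
    ∃ x, toMatrix x = B := by
  obtain ⟨x₁, hx₁⟩ := hN ⟨0, 0, 0, b, by simp, hb⟩
  obtain ⟨x₂, hx₂⟩ := hN ⟨0, b, 0, 0, hb, by simp⟩
  obtain ⟨x₃, hx₃⟩ := hN ⟨1, 0, 0, 0, by simp, by simp⟩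
  have h20 : B 2 0 = 0 := by
    have := congrFun (congrFun hx₁ 1) 0
    simpa [toMatrix, Matrix.mul_apply, Fin.sum_univ_four, hb0] using this
  have h30 : B 3 0 = 0 := by
    have := congrFun (congrFun hx₂ 0) 0
    simpa [toMatrix, Matrix.mul_apply, Fin.sum_univ_four, hb0] using this
  have h10 : B 1 0 = 0 := by
    have := congrFun (congrFun hx₃ 0) 0
    simpa [toMatrix, Matrix.mul_apply, Fin.sum_univ_four] using this
  have h21 : B 2 1 = 0 := by
    have := congrFun (congrFun hx₁ 1) 1
    simpa [toMatrix, Matrix.mul_apply, Fin.sum_univ_four, hb0, h10] using this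
  have e (j) := congrFun (congrFun h 0) j
  simp only [hyperbolicGram, Matrix.mul_apply, Fin.sum_univ_four, transpose_apply, map_apply] at e
  have e1 := e 1
  have e2 := e 2
  have e3 := e 3
  simp [h10, h20, h30] at e1 e2 e3
  have h00 : B 0 0 ≠ 0 := fun h0 => by simp [h0] at e3
  have h31 : B 3 1 = 0 := by simpa [h00] using e1
  have h32 : B 3 2 = 0 := by simpa [h00] using e2
  refine exists_toMatrix_eq h10 h20 h30 h21 h31 h32 (fun i => ?_) h
  have hup : ∀ i j : Fin 4, j < i → B i j = 0 := by
    intro i j hij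
    fin_cases i <;> fin_cases j <;> first | assumption | (exact absurd hij (by decide))
  have hd := (Matrix.upperTriangular_pow hup (p ^ k)).2 i
  rw [hk, Matrix.one_apply_eq] at hd
  have : (B i i - 1) ^ p ^ k = 0 := by rw [sub_pow_char_pow, ← hd]; simp
  exact sub_eq_zero.1 (pow_eq_zero_iff (pow_ne_zero _ (Fact.out : p.Prime).ne_zero) |>.1 this)

/-- The standard hermitian form is equivalent to the one with Gram matrix `hyperbolicGram K`. -/
lemma exists_basis_change {c t : K} (hc : c * star c = -1) (ht : star t + t = -1) :
    ∃ g h : Matrix (Fin 4) (Fin 4) K, g * h = 1 ∧ h * g = 1 ∧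
      gᵀ * g.map (starRingEnd K) = hyperbolicGram K := by
  let g : Matrix (Fin 4) (Fin 4) K :=
    !![1, 0, 0, 1 + t; c, 0, 0, t * c; 0, 1, 1 + t, 0; 0, c, t * c, 0]
  have hg : gᵀ * g.map (starRingEnd K) = hyperbolicGram K := by
    ext i j
    fin_cases i <;> fin_cases j <;>
      simp [g, hyperbolicGram, Matrix.mul_apply, Fin.sum_univ_four, starRingEnd_apply] <;> grind
  have hJ : hyperbolicGram K * hyperbolicGram K = 1 := by
    ext i j
    fin_cases i <;> fin_cases j <;> simp [hyperbolicGram, Matrix.mul_apply, Fin.sum_univ_four]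
  have hdet : IsUnit g.det := by
    have h1 : gᵀ * (g.map (starRingEnd K) * hyperbolicGram K) = 1 := by rw [← mul_assoc, hg, hJ]
    rw [← Matrix.det_transpose]
    exact Matrix.isUnit_det_of_right_inverse h1
  exact ⟨g, g⁻¹, Matrix.mul_nonsing_inv _ hdet, Matrix.nonsing_inv_mul _ hdet, hg⟩

end UnitaryUnipotent

open UnitaryUnipotent

section Conjugation

variable {M : Type*} [Monoid M] {g h : M}

lemma conj_conj_cancel (hhg : h * g = 1) (x : M) : h * (g * x * h) * g = x := by
  rw [show h * (g * x * h) * g = (h * g) * x * (h * g) by simp only [mul_assoc], hhg, one_mul,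
    mul_one]

lemma conj_mul_conj (hhg : h * g = 1) (x y : M) :
    g * x * h * (g * y * h) = g * (x * y) * h := by
  rw [show g * x * h * (g * y * h) = g * x * (h * g) * (y * h) by simp only [mul_assoc], hhg]
  simp only [mul_assoc, one_mul]

lemma mul_conj_eq_conj_mul (hgh : g * h = 1) (hhg : h * g = 1) {x y z : M}
    (hxyz : g * y * h * x = x * (g * z * h)) : y * (h * x * g) = h * x * g * z := by
  rw [← conj_conj_cancel hhg (y * (h * x * g)), ← conj_conj_cancel hhg (h * x * g * z),
    ← conj_mul_conj hhg y, ← conj_mul_conj hhg (h * x * g) z, conj_conj_cancel hgh, hxyz]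

end Conjugation

lemma Subgroup.map_equiv_centralizer {G H : Type*} [Group G] [Group H] (e : G ≃* H)
    (A : Subgroup G) : (centralizer (A : Set G)).map e.toMonoidHom =
      centralizer (A.map e.toMonoidHom : Set H) := by
  refine le_antisymm (map_centralizer_le_centralizer_image _ _) fun x hx => ?_
  refine ⟨e.symm x, mem_centralizer_iff.2 fun a ha => e.injective ?_, by simp⟩
  have := mem_centralizer_iff.1 hx (e a) ⟨a, ha, rfl⟩
  simpa using this

lemma Subgroup.map_equiv_center {G H : Type*} [Group G] [Group H] (e : G ≃* H) :
    (center G).map e.toMonoidHom = center H := by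
  have h := map_equiv_centralizer e ⊤
  rwa [map_top_of_surjective e.toMonoidHom e.surjective, coe_top, coe_top, centralizer_univ,
    centralizer_univ] at h

section PSU4

variable {p n : ℕ} [Fact p.Prime]

lemma frobq_frobq (x : GaloisField p (2 * n)) : frobq p n (frobq p n x) = x := by
  rcases Nat.eq_zero_or_pos n with rfl | hn
  · simp [frobq]
  · have : Fintype (GaloisField p (2 * n)) := Fintype.ofFinite _
    have h := FiniteField.pow_card x
    rw [← Nat.card_eq_fintype_card, GaloisField.card p (2 * n) (by omega)] at h
    simp only [frobq, iterateFrobenius_def]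
    rwa [← pow_mul, ← pow_add, ← two_mul]

/-- The field `GF(q²)` with the `q`-power Frobenius as its involution. -/
noncomputable instance : StarRing (GaloisField p (2 * n)) where
  star := frobq p n
  star_involutive := frobq_frobq
  star_mul x y := (map_mul _ x y).trans (mul_comm _ _)
  star_add := map_add _

/-- The element `g * B * h` of `SU₄(q)`, for `g` a basis with Gram matrix `hyperbolicGram`, `h` the
inverse of `g` and `B` an isometry of `hyperbolicGram` of determinant one. -/
noncomputable def SU4.ofGram {g h : Matrix (Fin 4) (Fin 4) (GaloisField p (2 * n))}
    (hgh : g * h = 1) (hg : gᵀ * g.map (starRingEnd _) = hyperbolicGram _)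
    (B : Matrix (Fin 4) (Fin 4) (GaloisField p (2 * n)))
    (hdet : B.det = 1) (hB : Bᵀ * hyperbolicGram _ * B.map (starRingEnd _) = hyperbolicGram _) :
    SU4 p n :=
  ⟨⟨g * B * h, by
    rw [det_mul, det_mul, hdet, mul_one, ← det_mul, hgh, det_one]⟩, by
    change (g * B * h)ᵀ * (g * B * h).map (starRingEnd _) = 1
    calc (g * B * h)ᵀ * (g * B * h).map (starRingEnd _)
        = hᵀ * (Bᵀ * (gᵀ * g.map (starRingEnd _)) * B.map (starRingEnd _)) *
            h.map (starRingEnd _) := by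
          simp only [transpose_mul, Matrix.map_mul, mul_assoc]
      _ = hᵀ * (gᵀ * g.map (starRingEnd _)) * h.map (starRingEnd _) := by rw [hg, hB]
      _ = (g * h)ᵀ * (g * h).map (starRingEnd _) := by
          simp only [transpose_mul, Matrix.map_mul, mul_assoc]
      _ = 1 := by simp [hgh]⟩

lemma SU4.gram_conj {g h : Matrix (Fin 4) (Fin 4) (GaloisField p (2 * n))} (hgh : g * h = 1)
    (hg : gᵀ * g.map (starRingEnd _) = hyperbolicGram _) (x : SU4 p n) :
    (h * x.1.1 * g)ᵀ * hyperbolicGram _ * (h * x.1.1 * g).map (starRingEnd _) =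
      hyperbolicGram _ := by
  have hx : (x.1.1)ᵀ * x.1.1.map (starRingEnd _) = 1 := x.2
  calc (h * x.1.1 * g)ᵀ * hyperbolicGram _ * (h * x.1.1 * g).map (starRingEnd _)
      = gᵀ * ((x.1.1)ᵀ * ((g * h)ᵀ * (g * h).map (starRingEnd _)) *
          x.1.1.map (starRingEnd _)) * g.map (starRingEnd _) := by
        rw [← hg]
        simp only [transpose_mul, Matrix.map_mul, mul_assoc]
    _ = hyperbolicGram _ := by simp [hgh, hx, hg]

/-- The embedding of the unipotent group in `SU₄(q)` given by a basis `g` with Gram matrix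
`hyperbolicGram`. -/
noncomputable def SU4.unipotentHom {g h : Matrix (Fin 4) (Fin 4) (GaloisField p (2 * n))}
    (hgh : g * h = 1) (hg : gᵀ * g.map (starRingEnd _) = hyperbolicGram _) :
    UnitaryUnipotent (GaloisField p (2 * n)) →* SU4 p n :=
  MonoidHom.mk' (fun x => SU4.ofGram hgh hg (toMatrix x) (det_toMatrix x) (toMatrix_gram x))
    fun x y => by
      refine Subtype.ext (Subtype.ext ?_)
      change g * toMatrix (x * y) * h = g * toMatrix x * h * (g * toMatrix y * h)
      rw [toMatrix_mul, conj_mul_conj (mul_eq_one_comm.1 hgh)]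

variable {g h : Matrix (Fin 4) (Fin 4) (GaloisField p (2 * n))} (hgh : g * h = 1)
    (hg : gᵀ * g.map (starRingEnd _) = hyperbolicGram _)

lemma SU4.coe_unipotentHom (x : UnitaryUnipotent (GaloisField p (2 * n))) :
    (SU4.unipotentHom hgh hg x).1.1 = g * toMatrix x * h := rfl

lemma SU4.unipotentHom_injective : Function.Injective (SU4.unipotentHom hgh hg) := by
  intro x y hxy
  apply toMatrix_injective
  have := congrArg (fun z : SU4 p n => h * z.1.1 * g) hxy
  simpa only [SU4.coe_unipotentHom, conj_conj_cancel (mul_eq_one_comm.1 hgh)] using this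

lemma SU4.mem_range_unipotentHom_of_normalizes
    {b : GaloisField p (2 * n)} (hb : star b = -b) (hb0 : b ≠ 0) (x : SU4 p n)
    (hx : ∀ y ∈ (SU4.unipotentHom hgh hg).range, x⁻¹ * y * x ∈ (SU4.unipotentHom hgh hg).range)
    (k : ℕ) (hk : x ^ p ^ k = 1) : x ∈ (SU4.unipotentHom hgh hg).range := by
  have hhg : h * g = 1 := mul_eq_one_comm.1 hgh
  have hpow (m : ℕ) : (h * x.1.1 * g) ^ m = h * (x ^ m).1.1 * g := by
    induction m with
    | zero => simp [hhg]
    | succ m ih =>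
      rw [pow_succ, ih, pow_succ x]
      change _ = h * ((x ^ m).1.1 * x.1.1) * g
      rw [conj_mul_conj hgh]
  obtain ⟨t, ht⟩ := exists_toMatrix_eq_of_normalizes p hb hb0 (B := h * x.1.1 * g)
    (fun y => by
      obtain ⟨t, ht⟩ := hx _ ⟨y, rfl⟩
      refine ⟨t, ?_⟩
      have h1 : SU4.unipotentHom hgh hg y * x = x * SU4.unipotentHom hgh hg t := by
        rw [ht]; group
      have h2 : g * toMatrix y * h * x.1.1 = x.1.1 * (g * toMatrix t * h) :=
        congrArg (fun z : SU4 p n => z.1.1) h1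
      exact mul_conj_eq_conj_mul hgh hhg h2)
    (SU4.gram_conj hgh hg x) (k := k) (by rw [hpow, hk]; simp [hhg])
  refine ⟨t, Subtype.ext (Subtype.ext ?_)⟩
  change g * toMatrix t * h = x.1.1
  rw [ht, conj_conj_cancel hgh]

lemma SU4.eq_one_of_unipotentHom_mem_center
    {b : GaloisField p (2 * n)} (hb : star b = -b) (hb0 : b ≠ 0)
    {c : GaloisField p (2 * n)} (hc : star c ≠ c) {x : UnitaryUnipotent (GaloisField p (2 * n))}
    (hx : SU4.unipotentHom hgh hg x ∈ Subgroup.center (SU4 p n)) : x = 1 := by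
  rw [Subgroup.mem_center_iff] at hx
  have hxc : x ∈ Subgroup.center (UnitaryUnipotent (GaloisField p (2 * n))) :=
    Subgroup.mem_center_iff.2 fun y => SU4.unipotentHom_injective hgh hg (by
      rw [map_mul, map_mul, hx])
  obtain ⟨hu, hw, hb'⟩ := (mem_center_iff hb hb0 hc).1 hxc
  let L : Matrix (Fin 4) (Fin 4) (GaloisField p (2 * n)) :=
    !![1, 0, 0, 0; 0, 1, 0, 0; 0, 0, 1, 0; b, 0, 0, 1]
  have hLdet : L.det = 1 := by
    simp [L, Matrix.det_succ_row_zero, Fin.sum_univ_succ]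
  have hL : Lᵀ * hyperbolicGram _ * L.map (starRingEnd _) = hyperbolicGram _ := by
    ext i j
    fin_cases i <;> fin_cases j <;>
      simp [L, hyperbolicGram, Matrix.mul_apply, Fin.sum_univ_four, starRingEnd_apply, hb]
  have h1 := hx (SU4.ofGram hgh hg L hLdet hL)
  have h2 : g * L * h * (g * toMatrix x * h) = g * toMatrix x * h * (g * L * h) :=
    congrArg (fun z : SU4 p n => z.1.1) h1
  have h3 : L * toMatrix x = toMatrix x * L := by
    have hhg : h * g = 1 := mul_eq_one_comm.1 hgh
    rw [conj_mul_conj hhg, conj_mul_conj hhg] at h2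
    rw [← conj_conj_cancel hhg (L * toMatrix x), h2, conj_conj_cancel hhg]
  have h4 := congrFun (congrFun h3 0) 0
  simp [L, toMatrix, Matrix.mul_apply, Fin.sum_univ_four, hu, hb0] at h4
  exact UnitaryUnipotent.ext hu h4 hw hb'

/-- The image of `SU4.unipotentHom` is a Sylow `p`-subgroup of `SU₄(q)`. -/
noncomputable def SU4.unipotentSylow
    {g h : Matrix (Fin 4) (Fin 4) (GaloisField p (2 * n))} (hgh : g * h = 1)
    (hg : gᵀ * g.map (starRingEnd _) = hyperbolicGram _)
    (hU : IsPGroup p (UnitaryUnipotent (GaloisField p (2 * n))))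
    {b : GaloisField p (2 * n)} (hb : star b = -b) (hb0 : b ≠ 0) : Sylow p (SU4 p n) where
  toSubgroup := (SU4.unipotentHom hgh hg).range
  isPGroup' := hU.of_surjective _ (SU4.unipotentHom hgh hg).rangeRestrict_surjective
  is_maximal' hQ hPQ :=
    IsPGroup.eq_of_normalizer (SU4.mem_range_unipotentHom_of_normalizes hgh hg hb hb0) hQ hPQ

/-- Every Sylow `p`-subgroup of `PSU₄(q)` is isomorphic to `UnitaryUnipotent GF(q²)`. -/
lemma PSU4.nonempty_unipotent_mulEquiv_sylow
    {g h : Matrix (Fin 4) (Fin 4) (GaloisField p (2 * n))} (hgh : g * h = 1)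
    (hg : gᵀ * g.map (starRingEnd _) = hyperbolicGram _)
    (hU : IsPGroup p (UnitaryUnipotent (GaloisField p (2 * n))))
    {b : GaloisField p (2 * n)} (hb : star b = -b) (hb0 : b ≠ 0)
    {c : GaloisField p (2 * n)} (hc : star c ≠ c) (S : Sylow p (PSU4 p n)) :
    Nonempty (UnitaryUnipotent (GaloisField p (2 * n)) ≃* (S : Subgroup (PSU4 p n))) := by
  let π := QuotientGroup.mk' (Subgroup.center (SU4 p n))
  let P := SU4.unipotentSylow hgh hg hU hb hb0
  let P' : Sylow p (PSU4 p n) := P.mapSurjective (QuotientGroup.mk'_surjective _)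
  have hinj : Function.Injective (π.comp (SU4.unipotentHom hgh hg)) :=
    (injective_iff_map_eq_one _).2 fun x hx =>
      SU4.eq_one_of_unipotentHom_mem_center hgh hg hb hb0 hc ((QuotientGroup.eq_one_iff _).1 hx)
  have hrange : (π.comp (SU4.unipotentHom hgh hg)).range = (P' : Subgroup (PSU4 p n)) :=
    MonoidHom.range_comp _ _
  exact ⟨((MonoidHom.ofInjective hinj).trans (MulEquiv.subgroupCongr hrange)).trans (P'.equiv S)⟩

end PSU4

/-- For `S` a Sylow `p`-subgroup of `PSU₄(q)`: `|S| = q⁶`, `|Z(S)| = q`,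
`|⁅S,S⁆| = q³` with `Z(S) ≤ ⁅S,S⁆`, and `J(S)` is elementary abelian of order `q⁴`,
contains `⁅S,S⁆`, and satisfies `C_S(J(S)) = J(S)`. -/
theorem psu4_sylow_structure
    (p n : ℕ) [Fact p.Prime] (hn : 0 < n) (q : ℕ) (hq : q = p ^ n)
    (S : Sylow p (PSU4 p n)) :
    Nat.card ↥(S : Subgroup (PSU4 p n)) = q ^ 6 ∧
    Nat.card ↥(Subgroup.center ↥(S : Subgroup (PSU4 p n))) = q ∧
    Nat.card ↥(⁅(⊤ : Subgroup ↥(S : Subgroup (PSU4 p n))), ⊤⁆ :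
      Subgroup ↥(S : Subgroup (PSU4 p n))) = q ^ 3 ∧
    Subgroup.center ↥(S : Subgroup (PSU4 p n)) ≤
      ⁅(⊤ : Subgroup ↥(S : Subgroup (PSU4 p n))), ⊤⁆ ∧
    IsElementaryAbelian p (Thompson p ↥(S : Subgroup (PSU4 p n))) ∧
    Nat.card ↥(Thompson p ↥(S : Subgroup (PSU4 p n))) = q ^ 4 ∧
    ⁅(⊤ : Subgroup ↥(S : Subgroup (PSU4 p n))), ⊤⁆ ≤ Thompson p ↥(S : Subgroup (PSU4 p n)) ∧
    Subgroup.centralizer (Thompson p ↥(S : Subgroup (PSU4 p n)) : Set ↥(S : Subgroup (PSU4 p n)))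
      = Thompson p ↥(S : Subgroup (PSU4 p n)) := by
  have hq1 : 1 < q := hq ▸ Nat.one_lt_pow hn.ne' (Fact.out : p.Prime).one_lt
  have hK : Nat.card (GaloisField p (2 * n)) = q ^ 2 := by
    rw [GaloisField.card p (2 * n) (by omega), hq, ← pow_mul, mul_comm]
  have hstar (x : GaloisField p (2 * n)) : star x = x ^ q := by
    rw [hq]
    exact iterateFrobenius_def p n x
  obtain ⟨hf, hs, hskew, hself⟩ := card_adjoint_and_surjective hq1 hK hstar
  obtain ⟨b, hb, hb0⟩ := exists_skew_ne_zero hq1 hs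
  obtain ⟨c, hc⟩ := exists_star_ne hq1 hK hf
  obtain ⟨d, hd⟩ := exists_mul_star_eq_neg_one hq1 hK hstar
  obtain ⟨t, ht⟩ := hself (-1) (by simp)
  obtain ⟨g, h, hgh, -, hg⟩ := exists_basis_change hd ht
  have hcard := UnitaryUnipotent.card_eq hK hs
  have hU : IsPGroup p (UnitaryUnipotent (GaloisField p (2 * n))) :=
    IsPGroup.of_card (n := n * 6) (by rw [hcard, hq, pow_mul])
  obtain ⟨e⟩ := PSU4.nonempty_unipotent_mulEquiv_sylow hgh hg hU hb hb0 hc S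
  have hT := Thompson_eq_radical p hq1 hK hs hf hc
  have hcomm : ⁅(⊤ : Subgroup ↥(S : Subgroup (PSU4 p n))), ⊤⁆ =
      (derived (GaloisField p (2 * n))).map e.toMonoidHom := by
    rw [← commutator_eq hb hb0 hskew, Subgroup.map_commutator,
      Subgroup.map_top_of_surjective e.toMonoidHom e.surjective]
  have hmap (A : Subgroup (UnitaryUnipotent (GaloisField p (2 * n)))) :
      Nat.card (A.map e.toMonoidHom) = Nat.card A :=
    Subgroup.card_map_of_injective e.injective
  rw [hcomm, ← Thompson_map p e, hT, ← Subgroup.map_equiv_center e,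
    ← Subgroup.map_equiv_centralizer, centralizer_radical hb hb0, hmap, hmap, hmap,
    card_center hb hb0 hc, card_radical hK hs, card_derived hK hs, ← Nat.card_congr e.toEquiv]
  refine ⟨hcard, hs, rfl, Subgroup.map_mono fun x hx => ?_, IsElementaryAbelian.map _ ?_, rfl,
    Subgroup.map_mono fun x hx => (mem_derived.1 hx).1, rfl⟩
  · obtain ⟨hu, -, hb⟩ := (mem_center_iff hb hb0 hc).1 hx
    exact mem_derived.2 ⟨hu, hb⟩
  · exact ⟨fun _ hx _ hy => radical_commute hx hy, fun _ hx => pow_char_of_mem_radical p hx⟩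
end

section
/- The exponent of the Sylow p-subgroup S of PSU_4(q) is: 4 if p = 2; 9 if p = 3; and p if p ≥ 5. -/
open Matrix

/-- If every `p`-element of `G` is killed by `p ^ (k + 1)` and the image of some `p`-element is not
killed by `p ^ k`, then the Sylow `p`-subgroups of a quotient of `G` have exponent `p ^ (k + 1)`. -/
theorem exponent_sylow_eq_of_surjective {G H : Type*} [Group G] [Finite G] [Group H]
    (p k : ℕ) [Fact p.Prime] (f : G →* H) (hf : Function.Surjective f)
    (hall : ∀ g : G, (∃ m, g ^ p ^ m = 1) → g ^ p ^ (k + 1) = 1)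
    (hex : ∃ g : G, (∃ m, g ^ p ^ m = 1) ∧ f (g ^ p ^ k) ≠ 1) (S : Sylow p H) :
    Monoid.exponent S = p ^ (k + 1) := by
  have : Finite H := Finite.of_surjective f hf
  apply Nat.dvd_antisymm
  · obtain ⟨P, rfl⟩ := Sylow.mapSurjective_surjective hf p S
    apply Monoid.exponent_dvd_of_forall_pow_eq_one
    rintro ⟨_, g, hg, rfl⟩
    obtain ⟨m, hm⟩ := P.isPGroup' ⟨g, hg⟩
    have hg1 := hall g ⟨m, by simpa [Subtype.ext_iff] using hm⟩
    refine Subtype.ext ?_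
    change f g ^ p ^ (k + 1) = 1
    rw [← map_pow, hg1, map_one]
  · obtain ⟨g, hg, hne⟩ := hex
    have hpg : IsPGroup p (Subgroup.zpowers (f g)) := by
      rintro ⟨_, j, rfl⟩
      refine ⟨k + 1, Subtype.ext ?_⟩
      change (f g ^ j) ^ p ^ (k + 1) = 1
      rw [← zpow_natCast, zpow_comm, zpow_natCast, ← map_pow, hall g hg, map_one, _root_.one_zpow]
    obtain ⟨Q, hQ⟩ := hpg.exists_le_sylow
    let x : Q := ⟨f g, hQ (Subgroup.mem_zpowers _)⟩
    have hx : orderOf x = p ^ (k + 1) := by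
      apply orderOf_eq_prime_pow
      · simpa [x, Subtype.ext_iff] using hne
      · simp [x, Subtype.ext_iff, ← map_pow, hall g hg]
    rw [← Monoid.exponent_eq_of_mulEquiv (Q.equiv S), ← hx]
    exact Monoid.order_dvd_exponent x

theorem Matrix.pow_card_eq_zero_of_isNilpotent_s7 {ι F : Type*} [Fintype ι] [DecidableEq ι]
    [Field F] {N : Matrix ι ι F} (hN : IsNilpotent N) : N ^ Fintype.card ι = 0 := by
  have h := (Matrix.isNilpotent_charpoly_sub_pow_of_isNilpotent hN).eq_zero
  have h2 := Matrix.aeval_self_charpoly N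
  rw [sub_eq_zero.mp h] at h2
  simpa using h2

theorem Matrix.pow_char_pow_eq_one {ι F : Type*} [Fintype ι] [DecidableEq ι] [Field F]
    {p : ℕ} [Fact p.Prime] [CharP F p] {M : Matrix ι ι F} {m k : ℕ} (hM : M ^ p ^ m = 1)
    (hk : Fintype.card ι ≤ p ^ k) : M ^ p ^ k = 1 := by
  cases isEmpty_or_nonempty ι
  · exact Subsingleton.elim _ _
  have hsub (j : ℕ) : (M - 1) ^ p ^ j = M ^ p ^ j - 1 := by
    rw [sub_pow_char_pow_of_commute p j (Commute.one_right M), one_pow]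
  have h := pow_card_eq_zero_of_isNilpotent_s7 (N := M - 1) ⟨p ^ m, by rw [hsub, hM, sub_self]⟩
  rw [← sub_eq_zero, ← hsub, pow_eq_zero_of_le hk h]

section

variable {p n : ℕ} [Fact p.Prime]

theorem frobq_apply (x : GaloisField p (2 * n)) : frobq p n x = x ^ p ^ n := by
  simp [frobq, iterateFrobenius_def]

theorem eq_one_of_pow_char_pow {F : Type*} [Field F] [CharP F p] {x : F} {m : ℕ}
    (h : x ^ p ^ m = 1) : x = 1 := by
  rw [← sub_eq_zero]
  refine pow_eq_zero_iff (pow_ne_zero m (Fact.out : p.Prime).ne_zero) |>.mp ?_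
  rw [sub_pow_char_pow, h, one_pow, sub_self]

/-- The inclusion of `SU₄(q)` into the matrix monoid. -/
def SU4ToMatrix (p n : ℕ) [Fact p.Prime] :
    SU4 p n →* Matrix (Fin 4) (Fin 4) (GaloisField p (2 * n)) where
  toFun g := ((g : SpecialLinearGroup (Fin 4) (GaloisField p (2 * n))) : Matrix _ _ _)
  map_one' := rfl
  map_mul' _ _ := rfl

theorem SU4ToMatrix_injective : Function.Injective (SU4ToMatrix p n) :=
  fun _ _ h => Subtype.ext (Subtype.ext h)

/-- A unipotent matrix preserving the Hermitian form lies in `SU₄(q)`. -/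
theorem exists_SU4_coe_eq (M : Matrix (Fin 4) (Fin 4) (GaloisField p (2 * n))) {m : ℕ}
    (hM : M ^ p ^ m = 1) (hu : Mᵀ * M.map (frobq p n) = 1) :
    ∃ g : SU4 p n, SU4ToMatrix p n g = M :=
  ⟨⟨⟨M, eq_one_of_pow_char_pow (p := p) (m := m) (by rw [← det_pow, hM, det_one])⟩, hu⟩, rfl⟩

theorem SU4_pow_eq_one_iff (g : SU4 p n) (j : ℕ) :
    g ^ j = 1 ↔ SU4ToMatrix p n g ^ j = 1 := by
  rw [← map_pow, ← map_one (SU4ToMatrix p n), SU4ToMatrix_injective.eq_iff]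

theorem exists_orderOf_eq (hn : 0 < n) :
    ∃ γ : GaloisField p (2 * n), orderOf γ = p ^ (2 * n) - 1 := by
  obtain ⟨γ, hγ⟩ := IsCyclic.exists_generator (α := (GaloisField p (2 * n))ˣ)
  refine ⟨γ, ?_⟩
  rw [orderOf_units, orderOf_eq_card_of_forall_mem_zpowers hγ, Nat.card_units,
    GaloisField.card p _ (by omega)]

theorem exists_norm_one_ne_one (hn : 0 < n) :
    ∃ ζ : GaloisField p (2 * n), ζ * ζ ^ p ^ n = 1 ∧ ζ ≠ 1 := by
  obtain ⟨γ, hγ⟩ := exists_orderOf_eq (p := p) hn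
  have hq : 1 < p ^ n := Nat.one_lt_pow hn.ne' (Fact.out : p.Prime).one_lt
  obtain ⟨r, hr⟩ : ∃ r, p ^ n = r + 1 := ⟨p ^ n - 1, by omega⟩
  have hord : orderOf γ = r * (r + 2) := by
    rw [hγ, mul_comm 2 n, pow_mul, hr]
    apply Nat.sub_eq_of_eq_add
    ring
  refine ⟨γ ^ r, ?_, fun h => ?_⟩
  · rw [← pow_succ', hr, ← pow_mul, ← hord, pow_orderOf_eq_one]
  · have h2 := Nat.le_of_dvd (by omega) (orderOf_dvd_of_pow_eq_one h)
    rw [hord] at h2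
    nlinarith

/-- In odd characteristic there are an element of norm `-1` and a nonzero element of trace `0`. -/
theorem exists_norm_neg_one_and_trace_zero (hn : 0 < n) (hp : p ≠ 2) :
    ∃ b t : GaloisField p (2 * n),
      b * b ^ p ^ n = -1 ∧ t ^ p ^ n = -t ∧ t ≠ 0 := by
  obtain ⟨γ, hγ⟩ := exists_orderOf_eq (p := p) hn
  have hq : 1 < p ^ n := Nat.one_lt_pow hn.ne' (Fact.out : p.Prime).one_lt
  obtain ⟨r, hr⟩ := ((Fact.out : p.Prime).odd_of_ne_two hp).pow (n := n)
  have hord : orderOf γ = (2 * r * (r + 1)) * 2 := by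
    rw [hγ, mul_comm 2 n, pow_mul, hr]
    apply Nat.sub_eq_of_eq_add
    ring
  have hr0 : 0 < r := by omega
  have hhalf : γ ^ (2 * r * (r + 1)) = -1 := by
    refine (sq_eq_one_iff.mp ?_).resolve_left ?_
    · rw [← pow_mul, ← hord, pow_orderOf_eq_one]
    · intro h
      have h2 := Nat.le_of_dvd (by positivity) (orderOf_dvd_of_pow_eq_one h)
      rw [hord] at h2
      nlinarith [Nat.mul_pos hr0 hr0]
  refine ⟨γ ^ r, γ ^ (r + 1), ?_, ?_, ?_⟩
  · rw [← pow_succ', hr, ← pow_mul, ← hhalf]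
    congr 1; ring
  · rw [hr, ← pow_mul, neg_eq_neg_one_mul, ← hhalf, ← pow_add]
    congr 1; ring
  · apply pow_ne_zero
    rintro rfl
    rw [zero_pow (by positivity)] at hhalf
    simp at hhalf

/-- The diagonal matrix with entries `ζ`, `ζ ^ q` at distinct positions `i`, `k` and `1` elsewhere
lies in `SU₄(q)` when `ζ` has norm `1`. -/
theorem exists_SU4_diagonal {ζ : GaloisField p (2 * n)} (hζ : ζ * ζ ^ p ^ n = 1)
    {i k : Fin 4} (hik : i ≠ k) :
    ∃ g : SU4 p n, SU4ToMatrix p n g =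
      diagonal (Function.update (Function.update 1 k (ζ ^ p ^ n)) i ζ) := by
  have hζ' : ζ ^ p ^ n * (ζ ^ p ^ n) ^ p ^ n = 1 := by rw [← mul_pow, hζ, one_pow]
  refine ⟨⟨⟨_, ?_⟩, ?_⟩, rfl⟩
  · change det (diagonal _) = 1
    rw [det_diagonal, Finset.prod_update_of_mem (Finset.mem_univ i),
      Finset.prod_update_of_mem (by simp [hik.symm])]
    simp [hζ]
  · change (diagonal _)ᵀ * (diagonal _).map _ = 1
    rw [diagonal_transpose, diagonal_map (map_zero _), diagonal_mul_diagonal, ← diagonal_one]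
    congr 1
    ext j
    by_cases hi : j = i
    · subst hi; simp [frobq_apply, hζ]
    · by_cases hk : j = k
      · subst hk; simp [hi, frobq_apply, hζ']
      · simp [hi, hk]

theorem SU4_center_apply_eq_zero (hn : 0 < n) {z : SU4 p n}
    (hz : z ∈ Subgroup.center (SU4 p n)) {i j : Fin 4} (hij : i ≠ j) :
    SU4ToMatrix p n z i j = 0 := by
  obtain ⟨ζ, hζ, hζ1⟩ := exists_norm_one_ne_one (p := p) hn
  obtain ⟨k, hki, hkj⟩ : ∃ k : Fin 4, i ≠ k ∧ j ≠ k := by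
    revert i j; decide
  obtain ⟨g, hg⟩ := exists_SU4_diagonal hζ hki
  have h := congrArg (fun x => SU4ToMatrix p n x i j) (Subgroup.mem_center_iff.mp hz g)
  simp only [map_mul, hg, diagonal_mul, mul_diagonal] at h
  simp only [Function.update_self, Function.update_of_ne hij.symm, Function.update_of_ne hkj,
    Pi.one_apply, mul_one] at h
  exact (mul_left_eq_self₀.mp h).resolve_left hζ1

theorem SU4_eq_one_of_mem_center (hn : 0 < n) {z : SU4 p n}
    (hz : z ∈ Subgroup.center (SU4 p n)) {m : ℕ} (hm : z ^ p ^ m = 1) : z = 1 := by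
  have hd : SU4ToMatrix p n z =
      diagonal fun i => SU4ToMatrix p n z i i := by
    ext i j
    by_cases h : i = j
    · subst h; simp
    · rw [diagonal_apply_ne _ h, SU4_center_apply_eq_zero hn hz h]
  rw [SU4_pow_eq_one_iff, hd, diagonal_pow, ← diagonal_one] at hm
  have h1 (i : Fin 4) : SU4ToMatrix p n z i i = 1 :=
    eq_one_of_pow_char_pow (p := p) (m := m) (congrFun (diagonal_injective hm) i)
  rw [← pow_one z, SU4_pow_eq_one_iff, pow_one, hd, ← diagonal_one]
  exact congrArg _ (funext h1)

theorem exponent_sylow_PSU4 (hn : 0 < n) (S : Sylow p (PSU4 p n)) (k : ℕ)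
    (hk : 4 ≤ p ^ (k + 1)) {M : Matrix (Fin 4) (Fin 4) (GaloisField p (2 * n))} {m : ℕ}
    (hM : M ^ p ^ m = 1) (hu : Mᵀ * M.map (frobq p n) = 1) (hne : M ^ p ^ k ≠ 1) :
    Monoid.exponent S = p ^ (k + 1) := by
  refine exponent_sylow_eq_of_surjective p k (QuotientGroup.mk' _)
    (QuotientGroup.mk'_surjective _) ?_ ?_ S
  · rintro g ⟨m, hm⟩
    rw [SU4_pow_eq_one_iff] at hm ⊢
    exact pow_char_pow_eq_one hm (by rwa [Fintype.card_fin])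
  · obtain ⟨g, rfl⟩ := exists_SU4_coe_eq M hM hu
    rw [← SU4_pow_eq_one_iff] at hM
    refine ⟨g, ⟨m, hM⟩, fun h => hne ?_⟩
    rw [← SU4_pow_eq_one_iff]
    refine SU4_eq_one_of_mem_center hn ((QuotientGroup.eq_one_iff _).mp h) (m := m) ?_
    rw [← pow_mul, mul_comm (p ^ k), pow_mul, hM, one_pow]

/-- A skew-Hermitian regular nilpotent matrix. -/
theorem exists_skewHermitian_nilpotent (hn : 0 < n) (hp : p ≠ 2) :
    ∃ N : Matrix (Fin 4) (Fin 4) (GaloisField p (2 * n)),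
      N.map (frobq p n) = -Nᵀ ∧ N ^ 4 = 0 ∧ N ^ 3 ≠ 0 := by
  obtain ⟨b, t, hb, ht, ht0⟩ := exists_norm_neg_one_and_trace_zero (p := p) hn hp
  have hc := frobq_apply (p := p) (n := n) b
  generalize b ^ p ^ n = c at hb hc
  have hcb : frobq p n c = b := by
    have h := congrArg (frobq p n) hb
    rw [map_mul, hc, map_neg, map_one, ← hb, mul_comm b c] at h
    refine mul_left_cancel₀ ?_ h
    rintro rfl
    simp at hb
  have hft : frobq p n t = -t := by rw [frobq_apply, ht]
  have h2 : (2 : GaloisField p (2 * n)) ≠ 0 := by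
    refine Ring.two_ne_zero ?_
    rwa [ringChar.eq (GaloisField p (2 * n)) p]
  let N : Matrix (Fin 4) (Fin 4) (GaloisField p (2 * n)) :=
    !![0, 0, -1, c; 0, 0, -b, -1; 1, c, t, t * c; -b, 1, t * b, -t]
  have hN2 : N ^ 2 =
      !![0, 0, -2 * t, -2 * t * c; 0, 0, -2 * t * b, 2 * t;
        2 * t, 2 * t * c, 0, 0; 2 * t * b, -2 * t, 0, 0] := by
    rw [pow_two]
    ext i j
    fin_cases i <;> fin_cases j <;> simp [N, mul_apply, Fin.sum_univ_four] <;> grind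
  have hN3 : N ^ 3 =
      !![-4 * t, -4 * t * c, 0, 0; -4 * t * b, 4 * t, 0, 0; 0, 0, 0, 0; 0, 0, 0, 0] := by
    rw [pow_succ, hN2]
    ext i j
    fin_cases i <;> fin_cases j <;> simp [N, mul_apply, Fin.sum_univ_four] <;> grind
  refine ⟨N, ?_, ?_, ?_⟩
  · ext i j
    fin_cases i <;> fin_cases j <;> simp [N, hc, hcb, hft]
  · rw [pow_succ, hN3]
    ext i j
    fin_cases i <;> fin_cases j <;> simp [N, mul_apply, Fin.sum_univ_four] <;> grind
  · rw [hN3]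
    intro h
    have h00 := congrFun (congrFun h 0) 0
    have h4 : (4 : GaloisField p (2 * n)) = 2 * 2 := by norm_num
    simp [h4, h2, ht0] at h00

/-- A unipotent isometry with a single Jordan block, as the Cayley transform of a regular nilpotent
skew-Hermitian matrix. -/
theorem exists_regular_unipotent (hn : 0 < n) (hp : p ≠ 2) :
    ∃ M : Matrix (Fin 4) (Fin 4) (GaloisField p (2 * n)),
      Mᵀ * M.map (frobq p n) = 1 ∧ M ^ p ^ 2 = 1 ∧ (M - 1) ^ 3 ≠ 0 := by
  obtain ⟨N, hN, hN4, hN3⟩ := exists_skewHermitian_nilpotent (p := p) hn hp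
  have h2 : (2 : GaloisField p (2 * n)) ≠ 0 := by
    refine Ring.two_ne_zero ?_
    rwa [ringChar.eq (GaloisField p (2 * n)) p]
  have hcube : (1 + 2 * N + 2 * N ^ 2 + 2 * N ^ 3 - 1) ^ 3 = 8 * N ^ 3 := by
    have h : (1 + 2 * N + 2 * N ^ 2 + 2 * N ^ 3 - 1) ^ 3 = 8 * N ^ 3 +
        N ^ 4 * (24 + 48 * N + 56 * N ^ 2 + 48 * N ^ 3 + 24 * N ^ 4 + 8 * N ^ 5) := by
      noncomm_ring
    rw [h, hN4, zero_mul, add_zero]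
  refine ⟨1 + 2 * N + 2 * N ^ 2 + 2 * N ^ 3, ?_, ?_, ?_⟩
  · have hmap : (1 + 2 * N + 2 * N ^ 2 + 2 * N ^ 3).map (frobq p n) =
        1 - 2 * Nᵀ + 2 * Nᵀ ^ 2 - 2 * Nᵀ ^ 3 := by
      change (frobq p n).mapMatrix _ = _
      have hN' : (frobq p n).mapMatrix N = -Nᵀ := hN
      simp only [map_add, map_mul, map_pow, map_one, map_ofNat, hN']
      noncomm_ring
    have htr : (1 + 2 * N + 2 * N ^ 2 + 2 * N ^ 3)ᵀ = 1 + 2 * Nᵀ + 2 * Nᵀ ^ 2 + 2 * Nᵀ ^ 3 := by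
      simp only [two_mul, transpose_add, transpose_one, transpose_pow]
    have hT4 : Nᵀ ^ 4 = 0 := by rw [← transpose_pow, hN4, transpose_zero]
    rw [hmap, htr]
    generalize Nᵀ = A at hT4
    have h : (1 + 2 * A + 2 * A ^ 2 + 2 * A ^ 3) * (1 - 2 * A + 2 * A ^ 2 - 2 * A ^ 3) =
        1 - A ^ 4 * (4 + 4 * A ^ 2) := by
      noncomm_ring
    rw [h, hT4, zero_mul, sub_zero]
  · have h4 : (1 + 2 * N + 2 * N ^ 2 + 2 * N ^ 3 - 1) ^ 4 = 0 := by
      have h : 8 * N ^ 3 * (1 + 2 * N + 2 * N ^ 2 + 2 * N ^ 3 - 1) =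
          N ^ 4 * (16 + 16 * N + 16 * N ^ 2) := by
        noncomm_ring
      rw [pow_succ, hcube, h, hN4, zero_mul]
    have hp2 : 4 ≤ p ^ 2 := by nlinarith [(Fact.out : p.Prime).two_le]
    have hsub := sub_pow_char_pow_of_commute p 2
      (Commute.one_right (1 + 2 * N + 2 * N ^ 2 + 2 * N ^ 3))
    rw [pow_eq_zero_of_le hp2 h4, one_pow] at hsub
    exact sub_eq_zero.mp hsub.symm
  · rw [hcube]
    have h8 : (8 : Matrix (Fin 4) (Fin 4) (GaloisField p (2 * n))) * N ^ 3 =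
        (2 ^ 3 : GaloisField p (2 * n)) • N ^ 3 := by
      rw [show (2 ^ 3 : GaloisField p (2 * n)) = ((8 : ℕ) : GaloisField p (2 * n)) by norm_num,
        Nat.cast_smul_eq_nsmul, nsmul_eq_mul, Nat.cast_ofNat]
    rw [h8]
    exact smul_ne_zero (pow_ne_zero 3 h2) hN3

end

/-- The exponent of a Sylow `p`-subgroup of `PSU₄(q)` is `4` if `p = 2`, `9` if `p = 3`,
and `p` if `p ≥ 5`. -/
theorem psu4_sylow_exponent
    (p n : ℕ) [Fact p.Prime] (hn : 0 < n) (S : Sylow p (PSU4 p n)) :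
    (p = 2 → Monoid.exponent ↥(S : Subgroup (PSU4 p n)) = 4) ∧
    (p = 3 → Monoid.exponent ↥(S : Subgroup (PSU4 p n)) = 9) ∧
    (5 ≤ p → Monoid.exponent ↥(S : Subgroup (PSU4 p n)) = p) := by
  refine ⟨?_, ?_, ?_⟩
  · rintro rfl
    let M : Matrix (Fin 4) (Fin 4) (GaloisField 2 (2 * n)) :=
      !![0, 0, 0, 1; 1, 0, 0, 0; 0, 1, 0, 0; 0, 0, 1, 0]
    have hM2 : M ^ 2 = !![0, 0, 1, 0; 0, 0, 0, 1; 1, 0, 0, 0; 0, 1, 0, 0] := by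
      rw [pow_two]
      ext i j
      fin_cases i <;> fin_cases j <;> simp [M, mul_apply, Fin.sum_univ_four]
    have hM4 : M ^ 2 ^ 2 = 1 := by
      rw [show 2 ^ 2 = 2 * 2 from rfl, pow_mul, hM2, pow_two]
      ext i j
      fin_cases i <;> fin_cases j <;> simp [mul_apply, Fin.sum_univ_four]
    refine exponent_sylow_PSU4 hn S 1 (by norm_num) hM4 ?_ ?_
    · ext i j
      fin_cases i <;> fin_cases j <;> simp [M, mul_apply, Fin.sum_univ_four]
    · rw [pow_one, hM2]
      intro h
      simpa using congrFun (congrFun h 0) 0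
  · rintro rfl
    obtain ⟨M, hu, hM, hne⟩ := exists_regular_unipotent (p := 3) hn (by norm_num)
    refine exponent_sylow_PSU4 hn S 1 (by norm_num) hM hu fun h => hne ?_
    have hsub := sub_pow_char_pow_of_commute 3 1 (Commute.one_right M)
    rwa [h, one_pow, sub_self, pow_one] at hsub
  · intro hp
    obtain ⟨M, hu, hM, hne⟩ := exists_regular_unipotent (p := p) hn (by omega)
    rw [exponent_sylow_PSU4 hn S 0 (by rw [zero_add, pow_one]; omega) hM hu fun h => hne ?_,
      zero_add, pow_one]
    rw [pow_zero, pow_one] at h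
    rw [h, sub_self, zero_pow three_ne_zero]
end
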